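/- arXiv:quant-ph/0504156 — 2 statements merged into one kernel-verified Lean document; each statement's English description precedes it below -/
import Mathlib

section
/- Let A be a finite set, d_B, d_E ∈ ℕ, and let ξ_B : A → density matrices on ℂ^{d_B}, ξ_E : A → density matrices on ℂ^{d_E}. Assume C(ξ_B) > C₁(ξ_E), where C(ξ_B) = max over probability distributions P on A of the Holevo quantity χ(P, ξ_B), and C₁(ξ_E) = max over probability distributions P on A and POVMs M on ℂ^{d_E} of the Shannon mutual information between input a ~ P and the outcome of measuring ξ_E(a) with M. Then there exists n ∈ ℕ such that the maximum over probability distributions P on Aⁿ and arbitrary (possibly entangled) POVMs on (ℂ^{d_B})^{⊗n} of the mutual information between input aⁿ ~ P and the outcome of measuring ξ_B(a₁) ⊗ ⋯ ⊗ ξ_B(a_n) is strictly greater than the maximum over probability distributions P on Aⁿ and factorized POVMs M₁ ⊗ ⋯ ⊗ M_n on (ℂ^{d_E})^{⊗n} of the mutual information between input aⁿ ~ P and the outcome of measuring ξ_E(a₁) ⊗ ⋯ ⊗ ξ_E(a_n). -/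
open scoped BigOperators ComplexOrder

noncomputable section

namespace QKD

/-- A probability distribution on a finite type. -/
def IsProbDist {α : Type*} [Fintype α] (P : α → ℝ) : Prop :=
  (∀ a, 0 ≤ P a) ∧ ∑ a, P a = 1

/-- A classical channel (stochastic matrix) from `α` to `β`. -/
def IsChannel {α β : Type*} [Fintype α] [Fintype β] (V : α → β → ℝ) : Prop :=
  (∀ a b, 0 ≤ V a b) ∧ ∀ a, ∑ b, V a b = 1

/-- Shannon entropy, in bits. -/
def entropy {α : Type*} [Fintype α] (P : α → ℝ) : ℝ :=
  (∑ a, Real.negMulLog (P a)) / Real.log 2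

/-- Shannon mutual information (in bits) of a joint distribution on `α × β`. -/
def miJoint {α β : Type*} [Fintype α] [Fintype β] (J : α → β → ℝ) : ℝ :=
  entropy (fun a => ∑ b, J a b) + entropy (fun b => ∑ a, J a b)
    - entropy (fun p : α × β => J p.1 p.2)

/-- `I(P,V)`: mutual information between input distributed by `P` and output of channel `V`. -/
def chanMI {α β : Type*} [Fintype α] [Fintype β] (P : α → ℝ) (V : α → β → ℝ) : ℝ :=
  miJoint (fun a b => P a * V a b)

/-- The n-fold memoryless extension of a channel. -/
def nfold {α β : Type*} (n : ℕ) (V : α → β → ℝ) : (Fin n → α) → (Fin n → β) → ℝ :=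
  fun a b => ∏ i, V (a i) (b i)

/-- Joint distribution of Alice's key `K_A` (uniform on `K`) and the key obtained
by sending `K_A` through the random coder `F`, the channel `V`, and the decoder `f`. -/
def keyJoint {K A B : Type*} [Fintype K] [Fintype A] [Fintype B] [DecidableEq K]
    (F : K → A → ℝ) (V : A → B → ℝ) (f : B → K) : K → K → ℝ :=
  fun k k' => (Fintype.card K : ℝ)⁻¹ * ∑ a, F k a * ∑ b, if f b = k' then V a b else 0

/-- A density matrix: positive semidefinite with trace 1. -/
def IsDensity {ι : Type*} [Fintype ι] (ρ : Matrix ι ι ℂ) : Prop :=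
  ρ.PosSemidef ∧ ρ.trace = 1

/-- A POVM with outcomes in `B`: positive semidefinite operators summing to the identity. -/
def IsPOVM {ι B : Type*} [Fintype ι] [DecidableEq ι] [Fintype B]
    (M : B → Matrix ι ι ℂ) : Prop :=
  (∀ b, (M b).PosSemidef) ∧ ∑ b, M b = 1

/-- Von Neumann entropy (in bits) of a Hermitian matrix, via its eigenvalues. -/
def vnEntropy {ι : Type*} [Fintype ι] [DecidableEq ι] (ρ : Matrix ι ι ℂ) : ℝ :=
  if h : ρ.IsHermitian then (∑ i, Real.negMulLog (h.eigenvalues i)) / Real.log 2 else 0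

/-- The Holevo quantity χ(P, ξ) of the ensemble `{P(a), ξ(a)}`. -/
def holevo {A ι : Type*} [Fintype A] [Fintype ι] [DecidableEq ι]
    (P : A → ℝ) (ξ : A → Matrix ι ι ℂ) : ℝ :=
  vnEntropy (∑ a, (P a : ℂ) • ξ a) - ∑ a, P a * vnEntropy (ξ a)

/-- Probability of outcome `b` when measuring the state `ρ` with the POVM `M`. -/
def measProb {ι B : Type*} [Fintype ι] (M : B → Matrix ι ι ℂ)
    (ρ : Matrix ι ι ℂ) (b : B) : ℝ :=
  ((M b * ρ).trace).re

/-- Mutual information (in bits) between an input `a ~ P` and the outcome of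
measuring `ξ(a)` with the POVM `M`. -/
def measMI {A ι B : Type*} [Fintype A] [Fintype ι] [Fintype B]
    (P : A → ℝ) (ξ : A → Matrix ι ι ℂ) (M : B → Matrix ι ι ℂ) : ℝ :=
  miJoint (fun a b => P a * measProb M (ξ a) b)

/-- The tensor-power state `ξ(a₁) ⊗ ⋯ ⊗ ξ(a_n)`. -/
def tensPow {A ι : Type*} {n : ℕ} (ξ : A → Matrix ι ι ℂ) (a : Fin n → A) :
    Matrix (Fin n → ι) (Fin n → ι) ℂ :=
  Matrix.of fun v w => ∏ i, ξ (a i) (v i) (w i)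

/-- The set of Holevo quantities over all input distributions. -/
def holevoSet {A ι : Type*} [Fintype A] [Fintype ι] [DecidableEq ι]
    (ξ : A → Matrix ι ι ℂ) : Set ℝ :=
  { x | ∃ P : A → ℝ, IsProbDist P ∧ x = holevo P ξ }

/-- The set of accessible informations: mutual informations achievable with some
input distribution and some POVM (with an arbitrary finite outcome set). -/
def accInfoSet {A ι : Type*} [Fintype A] [Fintype ι] [DecidableEq ι]
    (ξ : A → Matrix ι ι ℂ) : Set ℝ :=
  { x | ∃ (P : A → ℝ) (m : ℕ) (M : Fin m → Matrix ι ι ℂ),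
      IsProbDist P ∧ IsPOVM M ∧ x = measMI P ξ M }

/-! ### Classical information theory -/

lemma gibbs {X : Type*} [Fintype X] (p q : X → ℝ) (hp : ∀ x, 0 ≤ p x) (hq : ∀ x, 0 ≤ q x)
    (hac : ∀ x, q x = 0 → p x = 0) (hs : ∑ x, q x ≤ ∑ x, p x) :
    ∑ x, p x * Real.log (q x) ≤ ∑ x, p x * Real.log (p x) := by
  have key : ∀ x, p x * Real.log (q x) - p x * Real.log (p x) ≤ q x - p x := by
    intro x
    rcases (hp x).eq_or_lt with h | h
    · rw [← h]; simp [hq x]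
    · have hq' : 0 < q x := lt_of_le_of_ne (hq x) (fun h' => h.ne' (hac x h'.symm))
      have h1 := Real.log_le_sub_one_of_pos (div_pos hq' h)
      rw [Real.log_div hq'.ne' h.ne'] at h1
      have h2 := mul_le_mul_of_nonneg_left h1 h.le
      have h3 : p x * (q x / p x - 1) = q x - p x := by field_simp
      linarith
  have := Finset.sum_le_sum (fun x (_ : x ∈ Finset.univ) => key x)
  simp only [Finset.sum_sub_distrib] at this
  linarith

lemma log2_pos : 0 < Real.log 2 := Real.log_pos (by norm_num)

lemma mi_mul_log {α β : Type*} [Fintype α] [Fintype β] (P : α → ℝ) (V : α → β → ℝ)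
    (hV : IsChannel V) :
    miJoint (fun a b => P a * V a b) * Real.log 2 =
      ∑ a, Real.negMulLog (P a) + ∑ b, Real.negMulLog (∑ a, P a * V a b)
       - ∑ a, ∑ b, Real.negMulLog (P a * V a b) := by
  unfold miJoint entropy
  rw [← add_div, ← sub_div, div_mul_cancel₀ _ log2_pos.ne', Fintype.sum_prod_type]
  simp only [← Finset.mul_sum, hV.2, mul_one]

lemma mi_eq {α β : Type*} [Fintype α] [Fintype β] (P : α → ℝ) (V : α → β → ℝ)
    (hV : IsChannel V) :
    miJoint (fun a b => P a * V a b) * Real.log 2 =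
      ∑ b, Real.negMulLog (∑ a, P a * V a b) - ∑ a, P a * ∑ b, Real.negMulLog (V a b) := by
  rw [mi_mul_log P V hV]
  simp only [Real.negMulLog_mul, Finset.sum_add_distrib, ← Finset.sum_mul, hV.2, one_mul,
    ← Finset.mul_sum]
  ring

lemma mi_lower {α β : Type*} [Fintype α] [Fintype β] (P : α → ℝ) (V : α → β → ℝ)
    (hP : IsProbDist P) (hV : IsChannel V) (Q : α → β → ℝ) (hQ : ∀ a b, 0 ≤ Q a b)
    (hQ1 : ∀ b, ∑ a, Q a b ≤ 1) (hac : ∀ a b, Q a b = 0 → P a = 0) :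
    ∑ a, ∑ b, P a * V a b * (Real.log (Q a b) - Real.log (P a)) ≤
      miJoint (fun a b => P a * V a b) * Real.log 2 := by
  rw [mi_mul_log P V hV]
  set q : β → ℝ := fun b => ∑ a, P a * V a b with hq
  have hJ : ∀ a b, 0 ≤ P a * V a b := fun a b => mul_nonneg (hP.1 a) (hV.1 a b)
  have hq0 : ∀ b, 0 ≤ q b := fun b => Finset.sum_nonneg fun a _ => hJ a b
  have hqz : ∀ a b, q b = 0 → P a * V a b = 0 := fun a b h =>
    (Finset.sum_eq_zero_iff_of_nonneg (fun a _ => hJ a b)).1 h a (Finset.mem_univ a)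
  have hg := gibbs (X := α × β) (fun x => P x.1 * V x.1 x.2) (fun x => q x.2 * Q x.1 x.2)
    (fun x => hJ _ _) (fun x => mul_nonneg (hq0 _) (hQ _ _))
    (by
      intro x hx
      rcases mul_eq_zero.1 hx with h | h
      · exact hqz _ _ h
      · simp [hac _ _ h])
    (by
      rw [Fintype.sum_prod_type_right, Fintype.sum_prod_type_right]
      refine Finset.sum_le_sum fun b _ => ?_
      simp only
      rw [← Finset.mul_sum]
      exact mul_le_of_le_one_right (hq0 b) (hQ1 b))
  rw [Fintype.sum_prod_type, Fintype.sum_prod_type] at hg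
  simp only at hg
  have e1 : ∀ a b, P a * V a b * Real.log (q b * Q a b) =
      P a * V a b * Real.log (q b) + P a * V a b * Real.log (Q a b) := by
    intro a b
    by_cases h : P a * V a b = 0
    · simp [h]
    · rw [Real.log_mul (fun h' => h (hqz a b h')) (fun h' => h (by simp [hac a b h']))]
      ring
  simp only [e1, Finset.sum_add_distrib] at hg
  have e2 : ∑ a, ∑ b, P a * V a b * Real.log (q b) = ∑ b, q b * Real.log (q b) := by
    rw [Finset.sum_comm]
    simp only [← Finset.sum_mul, hq]
  have e3 : ∑ a, ∑ b, P a * V a b * Real.log (P a) = ∑ a, P a * Real.log (P a) := by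
    simp only [← Finset.sum_mul, ← Finset.mul_sum, hV.2, mul_one]
  simp only [mul_sub, Finset.sum_sub_distrib, Real.negMulLog, neg_mul, Finset.sum_neg_distrib]
  rw [e3]
  rw [e2] at hg
  linarith

lemma mi_nonneg {α β : Type*} [Fintype α] [Fintype β] (P : α → ℝ) (V : α → β → ℝ)
    (hP : IsProbDist P) (hV : IsChannel V) : 0 ≤ miJoint (fun a b => P a * V a b) := by
  have := mi_lower P V hP hV (fun a _ => P a) (fun a _ => hP.1 a) (fun _ => hP.2.le)
    (fun _ _ h => h)
  simp only [sub_self, mul_zero, Finset.sum_const_zero] at this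
  exact nonneg_of_mul_nonneg_left this log2_pos

lemma mi_upper {α β : Type*} [Fintype α] [Fintype β] (P : α → ℝ) (V : α → β → ℝ)
    (hP : IsProbDist P) (hV : IsChannel V) :
    miJoint (fun a b => P a * V a b) ≤ (Fintype.card α : ℝ) / Real.log 2 := by
  rw [le_div_iff₀ log2_pos, mi_mul_log P V hV]
  have h1 : ∑ a, Real.negMulLog (P a) ≤ Fintype.card α := by
    have : ∀ a ∈ Finset.univ, Real.negMulLog (P a) ≤ 1 := by
      intro a _
      have := Real.one_sub_inv_le_log_of_pos (x := P a)
      rcases (hP.1 a).eq_or_lt with h | h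
      · rw [← h]; simp
      · have h2 := mul_le_mul_of_nonneg_left (this h) h.le
        have h3 : P a * (1 - (P a)⁻¹) = P a - 1 := by field_simp
        simp only [Real.negMulLog]
        linarith
    refine (Finset.sum_le_sum this).trans (by simp)
  have h2 : ∑ b, Real.negMulLog (∑ a, P a * V a b) ≤ ∑ a, ∑ b, Real.negMulLog (P a * V a b) := by
    rw [Finset.sum_comm]
    refine Finset.sum_le_sum fun b _ => ?_
    simp only [Real.negMulLog, neg_mul, Finset.sum_neg_distrib, neg_le_neg_iff, Finset.sum_mul]
    refine Finset.sum_le_sum fun a _ => ?_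
    have hJ : ∀ a b, 0 ≤ P a * V a b := fun a b => mul_nonneg (hP.1 a) (hV.1 a b)
    rcases (hJ a b).eq_or_lt with h | h
    · rw [← h]; simp
    · exact mul_le_mul_of_nonneg_left (Real.log_le_log h
        (Finset.single_le_sum (fun a _ => hJ a b) (Finset.mem_univ a))) h.le
  linarith

/-- Fano-type bound for the uniform distribution on a set `C` of codewords. -/
lemma fano {α : Type*} [Fintype α] [DecidableEq α] (C : Finset α) (hC : C.Nonempty)
    (V : α → α → ℝ) (hV : IsChannel V) (lam : ℝ) (h : ∀ a ∈ C, 1 - lam ≤ V a a) :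
    IsProbDist (fun a => if a ∈ C then (C.card : ℝ)⁻¹ else 0) ∧
    (1 - lam) * Real.log C.card - Real.log 2 ≤
      miJoint (fun a b => (if a ∈ C then (C.card : ℝ)⁻¹ else 0) * V a b) * Real.log 2 := by
  have hN : (0 : ℝ) < C.card := by exact_mod_cast hC.card_pos
  have hN1 : (1 : ℝ) ≤ C.card := by exact_mod_cast hC.card_pos
  set P : α → ℝ := fun a => if a ∈ C then (C.card : ℝ)⁻¹ else 0 with hPdef
  have hP : IsProbDist P := by
    refine ⟨fun a => ?_, ?_⟩
    · simp only [hPdef]; split_ifs <;> positivity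
    · simp only [hPdef, Finset.sum_ite_mem, Finset.univ_inter, Finset.sum_const, nsmul_eq_mul]
      exact mul_inv_cancel₀ hN.ne'
  refine ⟨hP, ?_⟩
  refine le_trans ?_ (mi_lower P V hP hV (fun a b => (if a = b then 1 / 2 else 0) + P a / 2)
    (fun a b => by have := hP.1 a; split_ifs <;> linarith)
    (fun b => by
      rw [Finset.sum_add_distrib, ← Finset.sum_div, hP.2]
      simp; norm_num)
    (fun a b hab => by have := hP.1 a; split_ifs at hab <;> linarith))
  have key : ∀ a, (if a ∈ C then (C.card : ℝ)⁻¹ * ((1 - lam) * Real.log C.card - Real.log 2) else 0)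
      ≤ ∑ b, P a * V a b *
        (Real.log ((if a = b then 1 / 2 else 0) + P a / 2) - Real.log (P a)) := by
    intro a
    by_cases ha : a ∈ C
    · have hPa : P a = (C.card : ℝ)⁻¹ := by simp [hPdef, ha]
      have hlow : ∀ b, P a * V a b * ((if a = b then Real.log C.card else 0) - Real.log 2) ≤
          P a * V a b *
        (Real.log ((if a = b then 1 / 2 else 0) + P a / 2) - Real.log (P a)) := by
        intro b
        refine mul_le_mul_of_nonneg_left ?_ (mul_nonneg (hP.1 a) (hV.1 a b))
        rw [hPa, Real.log_inv]
        split_ifs with hab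
        · have : Real.log (1 / 2) ≤ Real.log (1 / 2 + (C.card : ℝ)⁻¹ / 2) :=
            Real.log_le_log (by norm_num) (by have := inv_pos.2 hN; linarith)
          rw [one_div, Real.log_inv] at this
          rw [one_div]
          linarith
        · rw [zero_add, Real.log_div (inv_pos.2 hN).ne' (by norm_num), Real.log_inv]
          linarith
      refine le_trans ?_ (Finset.sum_le_sum fun b _ => hlow b)
      rw [if_pos ha]
      have e : ∑ b, P a * V a b * ((if a = b then Real.log C.card else 0) - Real.log 2) =
          P a * (V a a * Real.log C.card - Real.log 2) := by
        simp only [mul_sub, Finset.sum_sub_distrib, ← Finset.sum_mul, ← Finset.mul_sum, hV.2]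
        simp [mul_assoc]
      rw [e, hPa]
      refine mul_le_mul_of_nonneg_left ?_ (inv_pos.2 hN).le
      have := mul_le_mul_of_nonneg_right (h a ha) (Real.log_nonneg hN1)
      linarith
    · have hPa : P a = 0 := by simp [hPdef, ha]
      simp [ha, hPa]
  refine le_trans (le_of_eq ?_) (Finset.sum_le_sum fun a _ => key a)
  rw [Finset.sum_ite_mem, Finset.univ_inter, Finset.sum_const, nsmul_eq_mul, ← mul_assoc,
    mul_inv_cancel₀ hN.ne', one_mul]

lemma sum_pi_prod {n : ℕ} {κ : Fin n → Type*} [∀ i, Fintype (κ i)] {R : Type*} [CommSemiring R]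
    (f : ∀ i, κ i → R) : ∑ e : (∀ i, κ i), ∏ i, f i (e i) = ∏ i, ∑ y, f i y := by
  classical
  rw [Finset.prod_univ_sum, Fintype.piFinset_univ]

lemma sum_pi_marg {n : ℕ} {κ : Fin n → Type*} [∀ i, Fintype (κ i)]
    (f : ∀ i, κ i → ℝ) (hf : ∀ i, ∑ y, f i y = 1) (i : Fin n) (g : κ i → ℝ) :
    ∑ e : (∀ i, κ i), (∏ j, f j (e j)) * g (e i) = ∑ y, f i y * g y := by
  classical
  let g' : ∀ j, κ j → ℝ := Function.update (fun j _ => 1) i g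
  have h1 : ∀ e : (∀ i, κ i), (∏ j, f j (e j)) * g (e i) = ∏ j, (f j (e j) * g' j (e j)) := by
    intro e
    rw [Finset.prod_mul_distrib]
    congr 1
    rw [Finset.prod_eq_single i]
    · simp [g']
    · intro j _ hj; simp [g', Function.update_of_ne hj]
    · simp
  simp only [h1]
  rw [sum_pi_prod (fun j y => f j y * g' j y), Finset.prod_eq_single i]
  · simp [g']
  · intro j _ hj; simp [g', Function.update_of_ne hj, hf]
  · simp

/-- Subadditivity of the mutual information over product channels. -/
lemma mi_product_le {A : Type*} [Fintype A] [DecidableEq A] {n : ℕ} {κ : Fin n → Type*}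
    [∀ i, Fintype (κ i)]
    (P : (Fin n → A) → ℝ) (hP : IsProbDist P) (V : ∀ i, A → κ i → ℝ)
    (hV : ∀ i, IsChannel (V i)) :
    (∀ i, IsProbDist (fun x => ∑ a : Fin n → A, if a i = x then P a else 0)) ∧
    miJoint (fun (a : Fin n → A) (e : ∀ i, κ i) => P a * ∏ i, V i (a i) (e i)) ≤
      ∑ i, miJoint (fun x y => (∑ a : Fin n → A, if a i = x then P a else 0) * V i x y) := by
  have hmarg : ∀ i (g : A → ℝ), ∑ x, (∑ a : Fin n → A, if a i = x then P a else 0) * g x =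
      ∑ a, P a * g (a i) := by
    intro i g
    simp only [Finset.sum_mul]
    rw [Finset.sum_comm]
    refine Finset.sum_congr rfl fun a _ => ?_
    simp
  have hpm : ∀ i, IsProbDist (fun x => ∑ a : Fin n → A, if a i = x then P a else 0) := by
    intro i
    refine ⟨fun x => Finset.sum_nonneg fun a _ => ?_, ?_⟩
    · have := hP.1 a
      split_ifs <;> simp [this]
    · have := hmarg i (fun _ => 1)
      simp only [mul_one] at this
      rw [this, hP.2]
  refine ⟨hpm, ?_⟩
  have hW : IsChannel (fun (a : Fin n → A) (e : ∀ i, κ i) => ∏ i, V i (a i) (e i)) := by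
    refine ⟨fun a e => Finset.prod_nonneg fun i _ => (hV i).1 _ _, fun a => ?_⟩
    rw [sum_pi_prod (fun i y => V i (a i) y)]
    simp [(hV _).2]
  refine le_of_mul_le_mul_right ?_ log2_pos
  rw [Finset.sum_mul, mi_eq P _ hW]
  simp only [fun i => mi_eq (fun x => ∑ a : Fin n → A, if a i = x then P a else 0) (V i) (hV i)]
  simp only [hmarg, Finset.sum_sub_distrib]
  -- conditional entropies
  have hc : ∀ a : Fin n → A, ∑ e : (∀ i, κ i), Real.negMulLog (∏ i, V i (a i) (e i)) =
      ∑ i, ∑ y, Real.negMulLog (V i (a i) y) := by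
    intro a
    have e1 : ∀ e : (∀ i, κ i), Real.negMulLog (∏ i, V i (a i) (e i)) =
        ∑ i, (∏ j, V j (a j) (e j)) * (-Real.log (V i (a i) (e i))) := by
      intro e
      rw [← Finset.mul_sum, Finset.sum_neg_distrib]
      by_cases h : ∏ j, V j (a j) (e j) = 0
      · simp [h]
      · rw [Real.negMulLog, Real.log_prod (fun i _ h' => h (Finset.prod_eq_zero (Finset.mem_univ i) h'))]
        ring
    simp only [e1]
    rw [Finset.sum_comm]
    refine Finset.sum_congr rfl fun i _ => ?_
    rw [sum_pi_marg (fun j y => V j (a j) y) (fun j => (hV j).2 _) i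
      (fun y => -Real.log (V i (a i) y))]
    refine Finset.sum_congr rfl fun y _ => ?_
    simp [Real.negMulLog]
  simp only [hc]
  have hc2 : ∑ a, P a * ∑ i, ∑ y, Real.negMulLog (V i (a i) y) =
      ∑ i, ∑ a, P a * ∑ y, Real.negMulLog (V i (a i) y) := by
    simp only [Finset.mul_sum]
    rw [Finset.sum_comm]
  rw [hc2]
  refine sub_le_sub_right ?_ _
  -- subadditivity of the output entropy
  set q : (∀ i, κ i) → ℝ := fun e => ∑ a, P a * ∏ i, V i (a i) (e i) with hq
  set r : ∀ i, κ i → ℝ := fun i y => ∑ a, P a * V i (a i) y with hr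
  have hterm : ∀ (a : Fin n → A) (e : ∀ i, κ i), 0 ≤ P a * ∏ i, V i (a i) (e i) := fun a e => mul_nonneg (hP.1 a) (hW.1 a e)
  have hq0 : ∀ e, 0 ≤ q e := fun e => Finset.sum_nonneg fun a _ => hterm a e
  have hr0 : ∀ i y, 0 ≤ r i y := fun i y =>
    Finset.sum_nonneg fun a _ => mul_nonneg (hP.1 a) ((hV i).1 _ _)
  have hrs : ∀ i, ∑ y, r i y = 1 := by
    intro i
    simp only [hr]
    rw [Finset.sum_comm]
    simp only [← Finset.mul_sum, (hV i).2, mul_one, hP.2]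
  have hqs : ∑ e, q e = 1 := by
    simp only [hq]
    rw [Finset.sum_comm]
    simp only [← Finset.mul_sum]
    rw [← hP.2]
    refine Finset.sum_congr rfl fun a _ => ?_
    rw [hW.2 a, mul_one]
  have hz : ∀ e i, r i (e i) = 0 → q e = 0 := by
    intro e i h
    have h1 := (Finset.sum_eq_zero_iff_of_nonneg
      (fun a _ => mul_nonneg (hP.1 a) ((hV i).1 (a i) (e i)))).1 h
    refine Finset.sum_eq_zero fun a ha => ?_
    rcases mul_eq_zero.1 (h1 a ha) with h2 | h2
    · simp [h2]
    · rw [Finset.prod_eq_zero (Finset.mem_univ i) h2, mul_zero]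
  have hg := gibbs q (fun e => ∏ i, r i (e i)) hq0
    (fun e => Finset.prod_nonneg fun i _ => hr0 i _)
    (fun e he => by
      obtain ⟨i, _, hi⟩ := Finset.prod_eq_zero_iff.1 he
      exact hz e i hi)
    (by rw [sum_pi_prod r, hqs]; simp [hrs])
  have e2 : ∑ e, q e * Real.log (∏ i, r i (e i)) = ∑ i, ∑ y, r i y * Real.log (r i y) := by
    have e3 : ∀ e, q e * Real.log (∏ i, r i (e i)) =
        ∑ i, ∑ a, P a * ((∏ j, V j (a j) (e j)) * Real.log (r i (e i))) := by
      intro e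
      have : ∀ i, ∑ a, P a * ((∏ j, V j (a j) (e j)) * Real.log (r i (e i))) =
          q e * Real.log (r i (e i)) := by
        intro i
        simp only [hq, Finset.sum_mul, mul_assoc]
      simp only [this, ← Finset.mul_sum]
      by_cases h : q e = 0
      · simp [h]
      · rw [Real.log_prod (fun i _ h' => h (hz e i h'))]
    simp only [e3]
    rw [Finset.sum_comm]
    refine Finset.sum_congr rfl fun i _ => ?_
    rw [Finset.sum_comm]
    simp only [← Finset.mul_sum]
    have : ∀ a : Fin n → A, ∑ e : (∀ i, κ i), (∏ j, V j (a j) (e j)) * Real.log (r i (e i)) =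
        ∑ y, V i (a i) y * Real.log (r i y) := fun a =>
      sum_pi_marg (fun j y => V j (a j) y) (fun j => (hV j).2 _) i (fun y => Real.log (r i y))
    simp only [this]
    simp only [Finset.mul_sum, hr, Finset.sum_mul, mul_assoc]
    rw [Finset.sum_comm]
  simp only [Real.negMulLog, neg_mul, Finset.sum_neg_distrib]
  rw [e2] at hg
  linarith

/-- Chernoff bound for product distributions. -/
lemma chernoff {X : Type*} [Fintype X] (p : X → ℝ) (hp : IsProbDist p) (f : X → ℝ)
    (δ : ℝ) (hδ : 0 < δ) :
    ∃ r : ℝ, 0 ≤ r ∧ r < 1 ∧ ∀ (n : ℕ) (B : (Fin n → X) → Prop) [DecidablePred B],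
      (∀ x, B x → ∏ i, p (x i) ≠ 0 → n * (∑ y, p y * f y + δ) ≤ ∑ i, f (x i)) →
      ∑ x, (if B x then ∏ i, p (x i) else 0) ≤ r ^ n := by
  set μ := ∑ y, p y * f y with hμ
  set G : ℝ := ∑ y, |f y - μ| with hG
  have hG0 : 0 ≤ G := Finset.sum_nonneg fun y _ => abs_nonneg _
  have hgG : ∀ y, |f y - μ| ≤ G := fun y =>
    Finset.single_le_sum (f := fun y => |f y - μ|) (fun y _ => abs_nonneg _) (Finset.mem_univ y)
  obtain ⟨t, ht0, ht1, ht2⟩ : ∃ t : ℝ, 0 < t ∧ t * G ≤ 1 ∧ t * G ^ 2 < δ := by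
    refine ⟨min (1 / (G + 1)) (δ / (G ^ 2 + 1)), by positivity, ?_, ?_⟩
    · calc _ ≤ 1 / (G + 1) * G := mul_le_mul_of_nonneg_right (min_le_left _ _) hG0
        _ ≤ 1 := by rw [div_mul_eq_mul_div, div_le_one (by linarith)]; linarith
    · calc _ ≤ δ / (G ^ 2 + 1) * G ^ 2 :=
            mul_le_mul_of_nonneg_right (min_le_right _ _) (by positivity)
        _ < δ := by rw [div_mul_eq_mul_div, div_lt_iff₀ (by positivity)]; nlinarith
  set S := ∑ y, p y * Real.exp (t * (f y - μ - δ)) with hS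
  have hS0 : 0 ≤ S := Finset.sum_nonneg fun y _ => mul_nonneg (hp.1 y) (Real.exp_pos _).le
  have hS1 : S < 1 := by
    have h1 : ∀ y, Real.exp (t * (f y - μ)) ≤ 1 + t * (f y - μ) + (t * G) ^ 2 := by
      intro y
      have hle : |t * (f y - μ)| ≤ t * G := by
        rw [abs_mul, abs_of_pos ht0]
        exact mul_le_mul_of_nonneg_left (hgG y) ht0.le
      have h2 := Real.abs_exp_sub_one_sub_id_le (hle.trans ht1)
      have h3 := (abs_le.1 h2).2
      have h4 : (t * (f y - μ)) ^ 2 ≤ (t * G) ^ 2 := sq_le_sq' (by linarith [(abs_le.1 hle).1]) (abs_le.1 hle).2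
      linarith
    have h5 : S = Real.exp (-(t * δ)) * ∑ y, p y * Real.exp (t * (f y - μ)) := by
      rw [hS, Finset.mul_sum]
      refine Finset.sum_congr rfl fun y _ => ?_
      rw [mul_left_comm, ← Real.exp_add]
      congr 2; ring
    have h6 : ∑ y, p y * Real.exp (t * (f y - μ)) ≤ 1 + (t * G) ^ 2 := by
      calc _ ≤ ∑ y, p y * (1 + t * (f y - μ) + (t * G) ^ 2) :=
            Finset.sum_le_sum fun y _ => mul_le_mul_of_nonneg_left (h1 y) (hp.1 y)
        _ = ∑ y, ((1 + (t * G) ^ 2 - t * μ) * p y + t * (p y * f y)) :=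
            Finset.sum_congr rfl fun y _ => by ring
        _ = 1 + (t * G) ^ 2 := by
            rw [Finset.sum_add_distrib, ← Finset.mul_sum, ← Finset.mul_sum, hp.2, ← hμ]; ring
    rw [h5]
    have h7 : 1 + (t * G) ^ 2 < Real.exp (t * δ) := by
      have := Real.add_one_le_exp (t * δ)
      nlinarith
    calc _ ≤ Real.exp (-(t * δ)) * (1 + (t * G) ^ 2) :=
          mul_le_mul_of_nonneg_left h6 (Real.exp_pos _).le
      _ < Real.exp (-(t * δ)) * Real.exp (t * δ) := mul_lt_mul_of_pos_left h7 (Real.exp_pos _)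
      _ = 1 := by rw [← Real.exp_add]; simp
  refine ⟨S, hS0, hS1, fun n B _ hB => ?_⟩
  have hSn : S ^ n = ∑ x : Fin n → X, ∏ i, (p (x i) * Real.exp (t * (f (x i) - μ - δ))) := by
    rw [sum_pi_prod (fun (_ : Fin n) y => p y * Real.exp (t * (f y - μ - δ)))]
    simp [hS]
  rw [hSn]
  refine Finset.sum_le_sum fun x _ => ?_
  have hpx : 0 ≤ ∏ i, p (x i) := Finset.prod_nonneg fun i _ => hp.1 _
  split_ifs with h
  · by_cases h0 : ∏ i, p (x i) = 0
    · rw [Finset.prod_mul_distrib, h0, zero_mul]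
    · rw [Finset.prod_mul_distrib, ← Real.exp_sum]
      refine le_mul_of_one_le_right hpx (Real.one_le_exp ?_)
      rw [← Finset.mul_sum]
      refine mul_nonneg ht0.le ?_
      have := hB x h h0
      simp only [Finset.sum_sub_distrib, Finset.sum_const, Finset.card_univ, Fintype.card_fin,
        nsmul_eq_mul]
      linarith
  · exact Finset.prod_nonneg fun i _ => mul_nonneg (hp.1 _) (Real.exp_pos _).le
set_option linter.unusedSectionVars false

/-! ### Matrix preliminaries -/

section Mat

open Matrix

variable {ι : Type*} [Fintype ι] [DecidableEq ι]

lemma spec {S : Matrix ι ι ℂ} (hS : S.IsHermitian) : ∃ U : Matrix ι ι ℂ,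
    Uᴴ * U = 1 ∧ U * Uᴴ = 1 ∧ S = U * diagonal (fun i => (hS.eigenvalues i : ℂ)) * Uᴴ := by
  refine ⟨hS.eigenvectorUnitary, ?_, ?_, ?_⟩
  · exact Unitary.coe_star_mul_self hS.eigenvectorUnitary
  · exact Unitary.coe_mul_star_self hS.eigenvectorUnitary
  · exact hS.spectral_theorem

lemma trace_conj_diag (U B : Matrix ι ι ℂ) (s : ι → ℂ) :
    (U * diagonal s * Uᴴ * B).trace = ∑ w, s w * (Uᴴ * B * U) w w := by
  rw [Matrix.mul_assoc, Matrix.mul_assoc, Matrix.trace_mul_comm, Matrix.mul_assoc,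
    Matrix.trace]
  simp [Matrix.diagonal_mul]

lemma trace_mul_nonneg {S T : Matrix ι ι ℂ} (hS : S.PosSemidef) (hT : T.PosSemidef) :
    0 ≤ (S * T).trace := by
  obtain ⟨U, _, _, h⟩ := spec hS.1
  rw [h, trace_conj_diag]
  refine Finset.sum_nonneg fun w _ => mul_nonneg ?_ ?_
  · exact_mod_cast hS.eigenvalues_nonneg w
  · exact (hT.conjTranspose_mul_mul_same U).diag_nonneg

lemma trace_mul_re_nonneg {S T : Matrix ι ι ℂ} (hS : S.PosSemidef) (hT : T.PosSemidef) :
    0 ≤ (S * T).trace.re := (Complex.le_def.1 (trace_mul_nonneg hS hT)).1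

lemma trace_mul_ofReal {S T : Matrix ι ι ℂ} (hS : S.PosSemidef) (hT : T.PosSemidef) :
    (S * T).trace = ((S * T).trace.re : ℂ) := by
  refine Complex.ext (by simp) ?_
  have := (Complex.le_def.1 (trace_mul_nonneg hS hT)).2
  simpa using this.symm

lemma psd_conj_diag (U : Matrix ι ι ℂ) (s : ι → ℝ) (hs : ∀ i, 0 ≤ s i) :
    (U * diagonal (fun i => (s i : ℂ)) * Uᴴ).PosSemidef := by
  refine Matrix.PosSemidef.mul_mul_conjTranspose_same (Matrix.PosSemidef.diagonal ?_) U
  intro i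
  simpa using hs i

lemma exists_sqrt {S : Matrix ι ι ℂ} (hS : S.PosSemidef) (hS1 : (1 - S).PosSemidef) :
    ∃ X : Matrix ι ι ℂ, Xᴴ = X ∧ X * X = S ∧ (X - S).PosSemidef := by
  obtain ⟨U, hU1, hU2, h⟩ := spec hS.1
  set s := hS.1.eigenvalues with hs
  have hs0 : ∀ i, 0 ≤ s i := hS.eigenvalues_nonneg
  have hs1 : ∀ i, s i ≤ 1 := by
    intro i
    have h1 := (hS1.conjTranspose_mul_mul_same U).diag_nonneg (i := i)
    have h2 : Uᴴ * (1 - S) * U = 1 - diagonal (fun i => (s i : ℂ)) := by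
      have : Uᴴ * S * U = diagonal (fun i => (s i : ℂ)) := by
        rw [h]
        calc _ = (Uᴴ * U) * diagonal (fun i => (s i : ℂ)) * (Uᴴ * U) := by
              simp only [Matrix.mul_assoc]
          _ = _ := by rw [hU1]; simp
      rw [Matrix.mul_sub, Matrix.sub_mul, this, Matrix.mul_one, hU1]
    rw [h2] at h1
    have h3 := (Complex.le_def.1 h1).1
    simp at h3
    linarith
  refine ⟨U * diagonal (fun i => ((Real.sqrt (s i) : ℝ) : ℂ)) * Uᴴ, ?_, ?_, ?_⟩
  · exact (psd_conj_diag U _ (fun i => Real.sqrt_nonneg _)).1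
  · conv_rhs => rw [h]
    calc _ = U * (diagonal (fun i => ((Real.sqrt (s i) : ℝ) : ℂ)) * (Uᴴ * U) *
          diagonal (fun i => ((Real.sqrt (s i) : ℝ) : ℂ))) * Uᴴ := by
          simp only [Matrix.mul_assoc]
      _ = _ := by
          rw [hU1, Matrix.mul_one, Matrix.diagonal_mul_diagonal]
          congr 3
          funext i
          rw [← Complex.ofReal_mul, Real.mul_self_sqrt (hs0 i)]
  · have : U * diagonal (fun i => ((Real.sqrt (s i) : ℝ) : ℂ)) * Uᴴ - S =
        U * diagonal (fun i => ((Real.sqrt (s i) - s i : ℝ) : ℂ)) * Uᴴ := by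
      conv_lhs => rw [h]
      rw [← Matrix.sub_mul, ← Matrix.mul_sub, Matrix.diagonal_sub]
      simp
    rw [this]
    refine psd_conj_diag U _ fun i => ?_
    have := Real.sqrt_le_sqrt (hs1 i)
    rw [Real.sqrt_one] at this
    nlinarith [Real.mul_self_sqrt (hs0 i), Real.sqrt_nonneg (s i)]

/-- The gentle-measurement operator inequality `1 - X T X ≤ 2 (1 - T) + 3 (1 - X²)`. -/
lemma gentle {X T : Matrix ι ι ℂ} (hX : Xᴴ = X) (hXS : (X - X * X).PosSemidef)
    (hT : T.PosSemidef) (hT1 : (1 - T).PosSemidef) :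
    ((2 : ℕ) • (1 - T) + (3 : ℕ) • (1 - X * X) - (1 - X * T * X)).PosSemidef := by
  have h1 := hT1.conjTranspose_mul_mul_same (1 + (1 - X))
  have h2 := hT.conjTranspose_mul_mul_same (1 - X)
  have e : (2 : ℕ) • (1 - T) + (3 : ℕ) • (1 - X * X) - (1 - X * T * X) =
      (1 + (1 - X))ᴴ * (1 - T) * (1 + (1 - X)) + ((1 - X)ᴴ * T * (1 - X) + (1 - X)ᴴ * T * (1 - X))
      + ((X - X * X) + (X - X * X) + (X - X * X) + (X - X * X)) := by
    simp only [conjTranspose_add, conjTranspose_sub, conjTranspose_one, hX]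
    noncomm_ring
  rw [e]
  exact (h1.add (h2.add h2)).add (((hXS.add hXS).add hXS).add hXS)

/-- Greedy construction of a maximal code. -/
lemma greedy {𝒜 : Type*} [Fintype 𝒜] [DecidableEq 𝒜] (ρ T : 𝒜 → Matrix ι ι ℂ)
    (hρ : ∀ a, IsDensity (ρ a)) (hT : ∀ a, (T a).PosSemidef) (hT1 : ∀ a, (1 - T a).PosSemidef)
    (K : ℝ) (hK : ∀ a, (T a).trace.re ≤ K) (lam : ℝ) (hlam : lam ≤ 3 / 4) :
    ∃ (C : Finset 𝒜) (D : 𝒜 → Matrix ι ι ℂ), (∀ a, (D a).PosSemidef) ∧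
      (1 - ∑ a, D a).PosSemidef ∧ (∀ a ∈ C, 1 - lam ≤ (D a * ρ a).trace.re) ∧
      (∑ a, D a).trace.re ≤ C.card * K ∧
      ∀ a, lam ≤ 2 * (ρ a * (1 - T a)).trace.re + 3 * (ρ a * ∑ b, D b).trace.re := by
  classical
  let code : Finset 𝒜 → (𝒜 → Matrix ι ι ℂ) → Prop := fun C D =>
    (∀ a, (D a).PosSemidef) ∧ (1 - ∑ a, D a).PosSemidef ∧ (∀ a, a ∉ C → D a = 0) ∧
    (∀ a ∈ C, 1 - lam ≤ (D a * ρ a).trace.re) ∧ (∑ a, D a).trace.re ≤ C.card * K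
  have h0 : code ∅ (fun _ => 0) := by
    refine ⟨fun _ => PosSemidef.zero, by simpa using PosSemidef.one, by simp, by simp, by simp⟩
  obtain ⟨C, hCm, hmax⟩ := Finset.exists_max_image
    (Finset.univ.filter fun C => ∃ D, code C D) Finset.card ⟨∅, by simpa using ⟨_, h0⟩⟩
  obtain ⟨D, hD⟩ := (Finset.mem_filter.1 hCm).2
  refine ⟨C, D, hD.1, hD.2.1, hD.2.2.2.1, hD.2.2.2.2, fun a => ?_⟩
  obtain ⟨hD0, hD1, hDC, hDs, hDt⟩ := hD
  have he : 0 ≤ (ρ a * (1 - T a)).trace.re := trace_mul_re_nonneg (hρ a).1 (hT1 a)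
  by_cases ha : a ∈ C
  · have h1 := hDs a ha
    have h2 : (D a * ρ a).trace.re ≤ (ρ a * ∑ b, D b).trace.re := by
      rw [Matrix.mul_sum, Matrix.trace_sum, Complex.re_sum, Matrix.trace_mul_comm]
      exact Finset.single_le_sum (f := fun b => (ρ a * D b).trace.re)
        (fun b _ => trace_mul_re_nonneg (hρ a).1 (hD0 b)) (Finset.mem_univ a)
    linarith
  · by_contra! hcon
    have hsum : (∑ b, D b).PosSemidef := posSemidef_sum _ fun b _ => hD0 b
    obtain ⟨X, hX, hXX, hXS⟩ := exists_sqrt hD1 (by simpa using hsum)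
    rw [← hXX] at hXS
    have hg := gentle hX hXS (hT a) (hT1 a)
    have hg2 := trace_mul_re_nonneg (hρ a).1 hg
    have hXX' : 1 - X * X = ∑ b, D b := by rw [hXX]; simp
    rw [hXX'] at hg2
    have htr : (ρ a).trace = 1 := (hρ a).2
    have hE : (X * T a * X).PosSemidef := by
      have := (hT a).conjTranspose_mul_mul_same X
      rwa [hX] at this
    have hgood : 1 - lam ≤ (X * T a * X * ρ a).trace.re := by
      rw [Matrix.trace_mul_comm (X * T a * X)]
      have e1 : (ρ a * ((2 : ℕ) • (1 - T a) + (3 : ℕ) • (∑ b, D b) - (1 - X * T a * X))).trace.re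
          = 2 * (ρ a * (1 - T a)).trace.re + 3 * (ρ a * ∑ b, D b).trace.re - 1
            + (ρ a * (X * T a * X)).trace.re := by
        rw [Matrix.mul_sub, Matrix.mul_add, Matrix.mul_smul, Matrix.mul_smul,
          Matrix.mul_sub (ρ a) 1 (X * T a * X), Matrix.mul_one]
        simp only [Matrix.trace_sub, Matrix.trace_add, Matrix.trace_smul, htr, Complex.sub_re,
          Complex.add_re, Complex.one_re]
        simp only [nsmul_eq_mul]
        simp
        ring
      rw [e1] at hg2
      linarith
    have hnew : code (insert a C) (fun b => D b + if b = a then X * T a * X else 0) := by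
      have hs : ∑ b, (D b + if b = a then X * T a * X else 0) = ∑ b, D b + X * T a * X := by
        rw [Finset.sum_add_distrib]; simp
      refine ⟨fun b => ?_, ?_, ?_, ?_, ?_⟩
      · refine (hD0 b).add ?_
        split_ifs
        · exact hE
        · exact PosSemidef.zero
      · rw [hs]
        have e : 1 - (∑ b, D b + X * T a * X) = Xᴴ * (1 - T a) * X := by
          rw [← sub_sub, ← hXX, hX]; noncomm_ring
        rw [e]
        exact (hT1 a).conjTranspose_mul_mul_same X
      · intro b hb
        rw [Finset.mem_insert, not_or] at hb
        simp [hDC b hb.2, hb.1]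
      · intro b hb
        by_cases hba : b = a
        · subst hba
          simpa [hDC b ha] using hgood
        · have hbC : b ∈ C := (Finset.mem_insert.1 hb).resolve_left hba
          simpa [hba] using hDs b hbC
      · rw [hs, Matrix.trace_add, Complex.add_re, Finset.card_insert_of_notMem ha]
        have h3 : (X * T a * X).trace.re ≤ (T a).trace.re := by
          have h4 := trace_mul_re_nonneg (hT a) hsum
          rw [← hXX', Matrix.mul_sub, Matrix.trace_sub, Matrix.mul_one, Complex.sub_re] at h4
          rw [Matrix.mul_assoc, Matrix.trace_mul_comm, Matrix.mul_assoc]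
          linarith
        push_cast
        linarith [hK a]
    have := hmax (insert a C) (by simpa using ⟨_, hnew⟩)
    rw [Finset.card_insert_of_notMem ha] at this
    omega

/-- Tensor products of matrices. -/
def tens {n : ℕ} (X : Fin n → Matrix ι ι ℂ) : Matrix (Fin n → ι) (Fin n → ι) ℂ :=
  Matrix.of fun v w => ∏ i, X i (v i) (w i)

lemma tens_mul {n : ℕ} (X Y : Fin n → Matrix ι ι ℂ) :
    tens X * tens Y = tens (fun i => X i * Y i) := by
  ext v w
  simp only [tens, Matrix.mul_apply, Matrix.of_apply, ← Finset.prod_mul_distrib]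
  exact sum_pi_prod (fun i k => X i (v i) k * Y i k (w i))

lemma tens_trace {n : ℕ} (X : Fin n → Matrix ι ι ℂ) :
    (tens X).trace = ∏ i, (X i).trace := by
  simp only [tens, Matrix.trace, Matrix.of_apply, Matrix.diag]
  exact sum_pi_prod (fun i k => X i k k)

lemma tens_conjTranspose {n : ℕ} (X : Fin n → Matrix ι ι ℂ) :
    (tens X)ᴴ = tens (fun i => (X i)ᴴ) := by
  ext v w
  simp [tens, Matrix.conjTranspose_apply]

lemma tens_diagonal {n : ℕ} (s : Fin n → ι → ℂ) :
    tens (fun i => diagonal (s i)) = diagonal (fun v => ∏ i, s i (v i)) := by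
  ext v w
  simp only [tens, Matrix.of_apply, Matrix.diagonal_apply]
  split_ifs with h
  · subst h; simp
  · obtain ⟨i, hi⟩ := Function.ne_iff.1 h
    exact Finset.prod_eq_zero (Finset.mem_univ i) (by simp [hi])

lemma tens_one {n : ℕ} : tens (fun _ : Fin n => (1 : Matrix ι ι ℂ)) = 1 := by
  have := tens_diagonal (n := n) (fun _ (_ : ι) => (1 : ℂ))
  simpa using this

lemma tens_psd {n : ℕ} (X : Fin n → Matrix ι ι ℂ) (hX : ∀ i, (X i).PosSemidef) :
    (tens X).PosSemidef := by
  choose U hU1 hU2 h using fun i => spec (hX i).1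
  have : tens X = tens U * diagonal (fun v => ((∏ i, (hX i).1.eigenvalues (v i) : ℝ) : ℂ)) *
      (tens U)ᴴ := by
    have e := tens_diagonal (fun i j => ((hX i).1.eigenvalues j : ℂ))
    push_cast
    rw [← e, tens_conjTranspose, tens_mul, tens_mul]
    congr 1
    funext i
    exact h i
  rw [this]
  exact psd_conj_diag _ _ fun v => Finset.prod_nonneg fun i _ => (hX i).eigenvalues_nonneg _

lemma tens_density {n : ℕ} (X : Fin n → Matrix ι ι ℂ) (hX : ∀ i, IsDensity (X i)) :
    IsDensity (tens X) := by
  refine ⟨tens_psd X fun i => (hX i).1, ?_⟩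
  rw [tens_trace]
  simp [(hX _).2]

lemma tensPow_eq {A : Type*} {n : ℕ} (ξ : A → Matrix ι ι ℂ) (a : Fin n → A) :
    tensPow ξ a = tens (fun i => ξ (a i)) := rfl

lemma meas_channel {A B : Type*} [Fintype A] [Fintype B] (ρ : A → Matrix ι ι ℂ)
    (hρ : ∀ a, IsDensity (ρ a)) (M : B → Matrix ι ι ℂ) (hM : IsPOVM M) :
    IsChannel (fun a b => measProb M (ρ a) b) := by
  refine ⟨fun a b => trace_mul_re_nonneg (hM.1 b) (hρ a).1, fun a => ?_⟩
  simp only [measProb]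
  rw [← Complex.re_sum, ← Matrix.trace_sum, ← Matrix.sum_mul, hM.2, Matrix.one_mul, (hρ a).2]
  simp

lemma eig_sum {S : Matrix ι ι ℂ} (hS : IsDensity S) : ∑ i, hS.1.1.eigenvalues i = 1 := by
  have h := hS.1.1.trace_eq_sum_eigenvalues
  have h2 := congrArg Complex.re (hS.2.symm.trans h)
  simpa using h2.symm

end Mat

section Coding

open Matrix

variable {ι : Type*} [Fintype ι] [DecidableEq ι]

lemma hsw_core {A : Type*} [Fintype A] [DecidableEq A] (P : A → ℝ) (hP : IsProbDist P)
    (ξ : A → Matrix ι ι ℂ) (hξ : ∀ a, IsDensity (ξ a))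
    (U : A → Matrix ι ι ℂ) (hU1 : ∀ a, (U a)ᴴ * U a = 1) (hU2 : ∀ a, U a * (U a)ᴴ = 1)
    (l : A → ι → ℝ) (hl : ∀ a, IsProbDist (l a))
    (hξU : ∀ a, ξ a = U a * diagonal (fun i => (l a i : ℂ)) * (U a)ᴴ)
    (W : Matrix ι ι ℂ) (hW1 : Wᴴ * W = 1) (hW2 : W * Wᴴ = 1) (s : ι → ℝ) (hs : IsProbDist s)
    (hσ : ∑ a, (P a : ℂ) • ξ a = W * diagonal (fun i => (s i : ℂ)) * Wᴴ)
    (δ : ℝ) (hδ : 0 < δ) (lam : ℝ) (hlam0 : 0 < lam) (hlam : lam ≤ 3 / 4) :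
    ∃ n₀ : ℕ, ∀ n ≥ n₀, ∃ (C : Finset (Fin n → A))
      (D : (Fin n → A) → Matrix (Fin n → ι) (Fin n → ι) ℂ),
      (∀ a, (D a).PosSemidef) ∧ (1 - ∑ a, D a).PosSemidef ∧
      (∀ a ∈ C, 1 - lam ≤ (D a * tensPow ξ a).trace.re) ∧
      lam / 12 * Real.exp (n * (∑ i, Real.negMulLog (s i)
        - ∑ a, P a * ∑ i, Real.negMulLog (l a i) - 2 * δ)) ≤ C.card := by
  set hs' := ∑ i, Real.negMulLog (s i) with hs'def
  set hl' := ∑ a, P a * ∑ i, Real.negMulLog (l a i) with hl'def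
  obtain ⟨r₁, hr₁0, hr₁1, hr₁⟩ := chernoff (X := A × ι) (fun x => P x.1 * l x.1 x.2)
    ⟨fun x => mul_nonneg (hP.1 _) ((hl _).1 _), by
      rw [Fintype.sum_prod_type]
      simp only [← Finset.mul_sum, (hl _).2, mul_one, hP.2]⟩
    (fun x => -Real.log (l x.1 x.2)) δ hδ
  obtain ⟨r₂, hr₂0, hr₂1, hr₂⟩ := chernoff s hs (fun i => Real.log (s i)) δ hδ
  have hμ1 : ∑ x : A × ι, P x.1 * l x.1 x.2 * -Real.log (l x.1 x.2) = hl' := by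
    rw [Fintype.sum_prod_type, hl'def]
    refine Finset.sum_congr rfl fun a _ => ?_
    rw [Finset.mul_sum]
    refine Finset.sum_congr rfl fun i _ => ?_
    simp only [Real.negMulLog]; ring
  have hμ2 : ∑ i, s i * Real.log (s i) = -hs' := by
    simp [hs'def, Real.negMulLog]
  simp only [hμ1] at hr₁
  simp only [hμ2] at hr₂
  have ht1 := (tendsto_pow_atTop_nhds_zero_of_lt_one hr₁0 hr₁1).eventually_lt_const
    (show (0 : ℝ) < lam / 4 by linarith)
  have ht2 := (tendsto_pow_atTop_nhds_zero_of_lt_one hr₂0 hr₂1).eventually_lt_const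
    (show (0 : ℝ) < lam / 12 by linarith)
  obtain ⟨n₀, hn₀⟩ := Filter.eventually_atTop.1 (ht1.and ht2)
  refine ⟨n₀, fun n hn => ?_⟩
  obtain ⟨hn1, hn2⟩ := hn₀ n hn
  set K : ℝ := Real.exp (n * (hl' + δ)) with hKdef
  -- unitary tensor powers
  set UU : (Fin n → A) → Matrix (Fin n → ι) (Fin n → ι) ℂ := fun a => tens (fun i => U (a i))
    with hUU
  have hUU1 : ∀ a, (UU a)ᴴ * UU a = 1 := by
    intro a
    simp only [hUU, tens_conjTranspose, tens_mul, hU1, tens_one]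
  have hUU2 : ∀ a, UU a * (UU a)ᴴ = 1 := by
    intro a
    simp only [hUU, tens_conjTranspose, tens_mul, hU2, tens_one]
  set L : (Fin n → A) → (Fin n → ι) → ℝ := fun a v => ∏ i, l (a i) (v i) with hL
  have hL0 : ∀ a v, 0 ≤ L a v := fun a v => Finset.prod_nonneg fun i _ => (hl _).1 _
  have hL1 : ∀ a, ∑ v, L a v = 1 := by
    intro a
    simp only [hL]
    rw [sum_pi_prod (fun i y => l (a i) y)]
    simp [(hl _).2]
  have hρ : ∀ a, tensPow ξ a = UU a * diagonal (fun v => (L a v : ℂ)) * (UU a)ᴴ := by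
    intro a
    have e := tens_diagonal (fun i j => (l (a i) j : ℂ))
    simp only [hL, hUU]
    push_cast
    rw [← e, tens_conjTranspose, tens_mul, tens_mul, tensPow_eq]
    congr 1
    funext i
    exact hξU (a i)
  -- the tests
  set χ : (Fin n → A) → (Fin n → ι) → ℝ := fun a v => if K⁻¹ ≤ L a v then 1 else 0 with hχ
  set T : (Fin n → A) → Matrix (Fin n → ι) (Fin n → ι) ℂ := fun a =>
    UU a * diagonal (fun v => (χ a v : ℂ)) * (UU a)ᴴ with hT
  have hK0 : 0 < K := Real.exp_pos _
  have hTpsd : ∀ a, (T a).PosSemidef := fun a => psd_conj_diag _ _ fun v => by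
    simp only [hχ]; split_ifs <;> norm_num
  have hTc : ∀ a, 1 - T a = UU a * diagonal (fun v => ((1 - χ a v : ℝ) : ℂ)) * (UU a)ᴴ := by
    intro a
    have : diagonal (fun v => ((1 - χ a v : ℝ) : ℂ)) = 1 - diagonal (fun v => (χ a v : ℂ)) := by
      rw [← Matrix.diagonal_one, Matrix.diagonal_sub]; simp
    rw [this, Matrix.mul_sub, Matrix.sub_mul, Matrix.mul_one, hUU2]
  have hTc1 : ∀ a, (1 - T a).PosSemidef := fun a => by
    rw [hTc]
    exact psd_conj_diag _ _ fun v => by simp only [hχ]; split_ifs <;> norm_num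
  have hTK : ∀ a, (T a).trace.re ≤ K := by
    intro a
    have e : (T a).trace = ((∑ v, χ a v : ℝ) : ℂ) := by
      have := trace_conj_diag (UU a) 1 (fun v => (χ a v : ℂ))
      rw [Matrix.mul_one, Matrix.mul_one, hUU1] at this
      rw [hT]; simp only; rw [this]; simp
    rw [e, Complex.ofReal_re]
    calc ∑ v, χ a v ≤ ∑ v, K * L a v := by
          refine Finset.sum_le_sum fun v _ => ?_
          simp only [hχ]
          split_ifs with h
          · have := mul_le_mul_of_nonneg_left h hK0.le
            rwa [mul_inv_cancel₀ hK0.ne'] at this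
          · exact mul_nonneg hK0.le (hL0 a v)
      _ = K := by rw [← Finset.mul_sum, hL1, mul_one]
  have hdens : ∀ a : Fin n → A, IsDensity (tensPow ξ a) := fun a => tens_density _ fun i => hξ (a i)
  obtain ⟨C, D, hD0, hD1, hDs, hDt, hDl⟩ := greedy (fun a => tensPow ξ a) T hdens hTpsd hTc1 K hTK
    lam hlam
  refine ⟨C, D, hD0, hD1, hDs, ?_⟩
  -- averaging
  set Pn : (Fin n → A) → ℝ := fun a => ∏ i, P (a i) with hPn
  have hPn0 : ∀ a, 0 ≤ Pn a := fun a => Finset.prod_nonneg fun i _ => hP.1 _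
  have hPn1 : ∑ a, Pn a = 1 := by
    simp only [hPn]
    rw [sum_pi_prod (fun (_ : Fin n) y => P y)]
    simp [hP.2]
  have hbar : ∑ a, Pn a * (tensPow ξ a * (1 - T a)).trace.re ≤ r₁ ^ n := by
    have e1 : ∀ a, (tensPow ξ a * (1 - T a)).trace.re = ∑ v, L a v * (1 - χ a v) := by
      intro a
      have e2 : (UU a)ᴴ * (1 - T a) * UU a = diagonal (fun v => ((1 - χ a v : ℝ) : ℂ)) := by
        rw [hTc]
        calc _ = ((UU a)ᴴ * UU a) * diagonal (fun v => ((1 - χ a v : ℝ) : ℂ)) *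
              ((UU a)ᴴ * UU a) := by simp only [Matrix.mul_assoc]
          _ = _ := by rw [hUU1]; simp
      rw [hρ, trace_conj_diag, e2, Complex.re_sum]
      refine Finset.sum_congr rfl fun v _ => ?_
      rw [Matrix.diagonal_apply_eq, ← Complex.ofReal_mul, Complex.ofReal_re]
    have h2 := hr₁ n (fun x => L (fun i => (x i).1) (fun i => (x i).2) < K⁻¹) (by
      intro x hx hne
      have hne' : ∀ i, l (x i).1 (x i).2 ≠ 0 := fun i h =>
        hne (Finset.prod_eq_zero (Finset.mem_univ i) (by simp [h]))
      have hpos : 0 < L (fun i => (x i).1) (fun i => (x i).2) :=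
        Finset.prod_pos fun i _ => lt_of_le_of_ne ((hl _).1 _) (hne' i).symm
      have h3 := Real.log_lt_log hpos hx
      rw [hKdef, ← Real.exp_neg, Real.log_exp] at h3
      simp only [hL] at h3
      rw [Real.log_prod (fun i _ => hne' i)] at h3
      rw [Finset.sum_neg_distrib]
      linarith)
    refine le_trans (le_of_eq ?_) h2
    rw [← (Equiv.arrowProdEquivProdArrow (Fin n) (fun _ => A) (fun _ => ι)).symm.sum_comp,
      Fintype.sum_prod_type]
    refine Finset.sum_congr rfl fun a _ => ?_
    rw [e1, Finset.mul_sum]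
    refine Finset.sum_congr rfl fun v _ => ?_
    simp only [Equiv.arrowProdEquivProdArrow, Equiv.coe_fn_symm_mk, Finset.prod_mul_distrib, hχ]
    by_cases h : K⁻¹ ≤ L a v
    · have h' : ¬ (L (fun i => a i) (fun i => v i) < K⁻¹) := not_lt.2 h
      rw [if_pos h, if_neg h']; ring
    · have h' : (L (fun i => a i) (fun i => v i) < K⁻¹) := not_le.1 h
      rw [if_neg h, if_pos h']; simp [hPn, hL]
  -- the average state
  set WW : Matrix (Fin n → ι) (Fin n → ι) ℂ := tens (fun _ => W) with hWW
  have hWW1 : WWᴴ * WW = 1 := by simp only [hWW, tens_conjTranspose, tens_mul, hW1, tens_one]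
  have hWW2 : WW * WWᴴ = 1 := by simp only [hWW, tens_conjTranspose, tens_mul, hW2, tens_one]
  set Sn : (Fin n → ι) → ℝ := fun w => ∏ i, s (w i) with hSn
  have hSn0 : ∀ w, 0 ≤ Sn w := fun w => Finset.prod_nonneg fun i _ => hs.1 _
  have hav : ∑ a, (Pn a : ℂ) • tensPow ξ a = WW * diagonal (fun w => (Sn w : ℂ)) * WWᴴ := by
    have e := tens_diagonal (n := n) (fun _ j => (s j : ℂ))
    simp only [hSn, hWW]
    push_cast
    rw [← e, tens_conjTranspose, tens_mul, tens_mul]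
    simp only [← hσ]
    ext v w
    simp only [tens, Matrix.of_apply, Matrix.sum_apply, Matrix.smul_apply, tensPow, hPn,
      smul_eq_mul]
    push_cast
    simp only [← Finset.prod_mul_distrib]
    exact sum_pi_prod (fun i x => (P x : ℂ) * ξ x (v i) (w i))
  set DD := ∑ a, D a with hDD
  have hDDpsd : DD.PosSemidef := posSemidef_sum _ fun a _ => hD0 a
  set dd : (Fin n → ι) → ℝ := fun w => ((WWᴴ * DD * WW) w w).re with hdd
  have hdd0 : ∀ w, 0 ≤ dd w := fun w =>
    (Complex.le_def.1 (hDDpsd.conjTranspose_mul_mul_same WW).diag_nonneg).1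
  have hdd1 : ∀ w, dd w ≤ 1 := by
    intro w
    have h1 := (Complex.le_def.1 ((hD1.conjTranspose_mul_mul_same WW).diag_nonneg (i := w))).1
    rw [Matrix.mul_sub, Matrix.sub_mul, Matrix.mul_one, hWW1] at h1
    simp at h1
    simp only [hdd]
    linarith
  have hddt : ∑ w, dd w = DD.trace.re := by
    have : (WWᴴ * DD * WW).trace = DD.trace := by
      rw [Matrix.trace_mul_comm, ← Matrix.mul_assoc, hWW2, Matrix.one_mul]
    rw [← this, Matrix.trace, Complex.re_sum]
    rfl
  have hdbar : ∑ a, Pn a * (tensPow ξ a * DD).trace.re = ∑ w, Sn w * dd w := by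
    have e1 : ((∑ a, (Pn a : ℂ) • tensPow ξ a) * DD).trace.re =
        ∑ a, Pn a * (tensPow ξ a * DD).trace.re := by
      rw [Matrix.sum_mul, Matrix.trace_sum, Complex.re_sum]
      refine Finset.sum_congr rfl fun a _ => ?_
      rw [Matrix.smul_mul, Matrix.trace_smul, smul_eq_mul, Complex.re_ofReal_mul]
    rw [← e1, hav, trace_conj_diag, Complex.re_sum]
    refine Finset.sum_congr rfl fun w _ => ?_
    rw [Complex.re_ofReal_mul]
  have hlow : lam / 6 ≤ ∑ w, Sn w * dd w := by
    have h1 := Finset.sum_le_sum (fun a (_ : a ∈ Finset.univ) =>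
      mul_le_mul_of_nonneg_left (hDl a) (hPn0 a))
    rw [← Finset.sum_mul, hPn1, one_mul] at h1
    have e : ∑ a, Pn a * (2 * (tensPow ξ a * (1 - T a)).trace.re +
        3 * (tensPow ξ a * DD).trace.re) = 2 * ∑ a, Pn a * (tensPow ξ a * (1 - T a)).trace.re
        + 3 * ∑ a, Pn a * (tensPow ξ a * DD).trace.re := by
      rw [Finset.mul_sum, Finset.mul_sum, ← Finset.sum_add_distrib]
      exact Finset.sum_congr rfl fun a _ => by ring
    rw [e, hdbar] at h1
    linarith
  set κ : ℝ := Real.exp (n * (-hs' + δ)) with hκ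
  have hup : ∑ w, Sn w * dd w ≤ r₂ ^ n + κ * DD.trace.re := by
    have h2 := hr₂ n (fun w => κ < Sn w) (by
      intro w hw hne
      have h3 := Real.log_lt_log (Real.exp_pos _) hw
      rw [Real.log_exp] at h3
      simp only [hSn] at h3
      rw [Real.log_prod (fun i _ h => hne (Finset.prod_eq_zero (Finset.mem_univ i) h))] at h3
      exact h3.le)
    rw [← hddt, Finset.mul_sum]
    refine le_trans ?_ (add_le_add_left h2 _)
    rw [← Finset.sum_add_distrib]
    refine Finset.sum_le_sum fun w _ => ?_
    split_ifs with h
    · have h3 := mul_le_mul_of_nonneg_left (hdd1 w) (hSn0 w)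
      have h4 := mul_nonneg (Real.exp_pos (n * (-hs' + δ))).le (hdd0 w)
      simp only [hSn] at h3 ⊢
      linarith
    · rw [zero_add]
      exact mul_le_mul_of_nonneg_right (not_lt.1 h) (hdd0 w)
  have hfin : lam / 12 ≤ κ * (C.card * K) := by
    have := mul_le_mul_of_nonneg_left hDt (Real.exp_pos (n * (-hs' + δ))).le
    linarith
  have hprod : Real.exp (n * (hs' - hl' - 2 * δ)) * (κ * K) = 1 := by
    rw [hκ, hKdef, ← Real.exp_add, ← Real.exp_add, Real.exp_eq_one_iff]
    ring
  calc lam / 12 * Real.exp (n * (hs' - hl' - 2 * δ))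
      ≤ κ * (C.card * K) * Real.exp (n * (hs' - hl' - 2 * δ)) :=
        mul_le_mul_of_nonneg_right hfin (Real.exp_pos _).le
    _ = C.card * (Real.exp (n * (hs' - hl' - 2 * δ)) * (κ * K)) := by ring
    _ = C.card := by rw [hprod, mul_one]

lemma avg_density {A : Type*} [Fintype A] (P : A → ℝ) (hP : IsProbDist P)
    (ξ : A → Matrix ι ι ℂ) (hξ : ∀ a, IsDensity (ξ a)) : IsDensity (∑ a, (P a : ℂ) • ξ a) := by
  refine ⟨posSemidef_sum _ fun a _ => (hξ a).1.smul (by exact_mod_cast hP.1 a), ?_⟩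
  rw [Matrix.trace_sum]
  simp only [Matrix.trace_smul, (hξ _).2, smul_eq_mul, mul_one]
  exact_mod_cast hP.2

lemma vnEntropy_mul {S : Matrix ι ι ℂ} (hS : S.IsHermitian) :
    vnEntropy S * Real.log 2 = ∑ i, Real.negMulLog (hS.eigenvalues i) := by
  rw [vnEntropy, dif_pos hS, div_mul_cancel₀ _ log2_pos.ne']

lemma hsw {A : Type*} [Fintype A] [DecidableEq A] (P : A → ℝ) (hP : IsProbDist P)
    (ξ : A → Matrix ι ι ℂ) (hξ : ∀ a, IsDensity (ξ a))
    (δ : ℝ) (hδ : 0 < δ) (lam : ℝ) (hlam0 : 0 < lam) (hlam : lam ≤ 3 / 4) :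
    ∃ n₀ : ℕ, ∀ n ≥ n₀, ∃ (C : Finset (Fin n → A))
      (D : (Fin n → A) → Matrix (Fin n → ι) (Fin n → ι) ℂ),
      (∀ a, (D a).PosSemidef) ∧ (1 - ∑ a, D a).PosSemidef ∧
      (∀ a ∈ C, 1 - lam ≤ (D a * tensPow ξ a).trace.re) ∧
      lam / 12 * Real.exp (n * (holevo P ξ * Real.log 2 - 2 * δ)) ≤ C.card := by
  have hσ := avg_density P hP ξ hξ
  choose U hU1 hU2 hU using fun a => spec (hξ a).1.1
  obtain ⟨W, hW1, hW2, hW⟩ := spec hσ.1.1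
  have := hsw_core P hP ξ hξ U hU1 hU2 (fun a => (hξ a).1.1.eigenvalues)
    (fun a => ⟨(hξ a).1.eigenvalues_nonneg, eig_sum (hξ a)⟩) hU W hW1 hW2 hσ.1.1.eigenvalues
    ⟨hσ.1.eigenvalues_nonneg, eig_sum hσ⟩ hW δ hδ lam hlam0 hlam
  have e : holevo P ξ * Real.log 2 = ∑ i, Real.negMulLog (hσ.1.1.eigenvalues i)
      - ∑ a, P a * ∑ i, Real.negMulLog ((hξ a).1.1.eigenvalues i) := by
    rw [holevo, sub_mul, vnEntropy_mul hσ.1.1, Finset.sum_mul]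
    congr 1
    refine Finset.sum_congr rfl fun a _ => ?_
    rw [mul_assoc, vnEntropy_mul (hξ a).1.1]
  rw [e]
  exact this

lemma miJoint_reindex {α β γ : Type*} [Fintype α] [Fintype β] [Fintype γ] (e : γ ≃ β)
    (J : α → β → ℝ) : miJoint (fun a c => J a (e c)) = miJoint J := by
  unfold miJoint entropy
  have h1 : ∀ a, ∑ c, J a (e c) = ∑ b, J a b := fun a => e.sum_comp (fun b => J a b)
  have h2 : ∑ c, Real.negMulLog (∑ a, J a (e c)) = ∑ b, Real.negMulLog (∑ a, J a b) :=
    e.sum_comp (fun b => Real.negMulLog (∑ a, J a b))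
  have h3 : ∑ p : α × γ, Real.negMulLog (J p.1 (e p.2)) =
      ∑ p : α × β, Real.negMulLog (J p.1 p.2) := by
    rw [Fintype.sum_prod_type, Fintype.sum_prod_type]
    exact Finset.sum_congr rfl fun a _ => e.sum_comp (fun b => Real.negMulLog (J a b))
  simp only [h1, h2, h3]

/-- Achievability: rates below the Holevo quantity are achieved by collective measurements. -/
lemma achieve {A : Type*} [Fintype A] [Nonempty A] (P : A → ℝ) (hP : IsProbDist P)
    (ξ : A → Matrix ι ι ℂ) (hξ : ∀ a, IsDensity (ξ a)) (R : ℝ) (hR0 : 0 ≤ R)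
    (hR : R < holevo P ξ) :
    ∃ (n : ℕ) (Q : (Fin n → A) → ℝ) (m : ℕ) (M : Fin m → Matrix (Fin n → ι) (Fin n → ι) ℂ),
      IsProbDist Q ∧ IsPOVM M ∧
      n * R < miJoint (fun a b => Q a * measProb M (tensPow ξ a) b) := by
  classical
  set Δ := holevo P ξ * Real.log 2 with hΔ
  set R' := R * Real.log 2 with hR'
  have hR'0 : 0 ≤ R' := mul_nonneg hR0 log2_pos.le
  have hgap : R' < Δ := mul_lt_mul_of_pos_right hR log2_pos
  set g := Δ - R' with hg
  have hg0 : 0 < g := sub_pos.2 hgap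
  have hΔ0 : 0 < Δ := lt_of_le_of_lt hR'0 hgap
  set lam := g / (4 * Δ) with hlam
  have hlam0 : 0 < lam := by positivity
  have hlamΔ : lam * Δ = g / 4 := by rw [hlam]; field_simp
  have hlam1 : lam ≤ 1 / 4 := by
    rw [hlam, div_le_iff₀ (by positivity)]; linarith
  obtain ⟨n₀, hn₀⟩ := hsw P hP ξ hξ (g / 8) (by positivity) lam hlam0 (by linarith)
  obtain ⟨n₁, hn₁⟩ := exists_nat_gt ((Real.log 2 - (1 - lam) * Real.log (lam / 12)) / (g / 2))
  set n := max n₀ n₁ with hn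
  obtain ⟨C, D, hD0, hD1, hDs, hC⟩ := hn₀ n (le_max_left _ _)
  have hnn : Real.log 2 - (1 - lam) * Real.log (lam / 12) < n * (g / 2) := by
    have h1 : ((n₁ : ℕ) : ℝ) ≤ (n : ℝ) := by exact_mod_cast le_max_right _ _
    have h2 := lt_of_lt_of_le hn₁ h1
    rwa [div_lt_iff₀ (by positivity)] at h2
  have hCpos : (0 : ℝ) < C.card := lt_of_lt_of_le (by positivity) hC
  have hCne : C.Nonempty := by
    rw [← Finset.card_pos]; exact_mod_cast hCpos
  obtain ⟨a₀⟩ : Nonempty (Fin n → A) := inferInstance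
  set M : (Fin n → A) → Matrix (Fin n → ι) (Fin n → ι) ℂ :=
    fun a => D a + if a = a₀ then 1 - ∑ b, D b else 0 with hM
  have hrest : ∀ a, (if a = a₀ then 1 - ∑ b, D b else 0 :
      Matrix (Fin n → ι) (Fin n → ι) ℂ).PosSemidef := by
    intro a
    split_ifs
    · exact hD1
    · exact PosSemidef.zero
  have hMP : IsPOVM M := by
    refine ⟨fun a => (hD0 a).add (hrest a), ?_⟩
    simp only [hM, Finset.sum_add_distrib]
    simp
  have hdens : ∀ a : Fin n → A, IsDensity (tensPow ξ a) := fun a => tens_density _ fun i => hξ (a i)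
  have hch := meas_channel (fun a => tensPow ξ a) hdens M hMP
  obtain ⟨hQ, hmi⟩ := fano C hCne (fun a b => measProb M (tensPow ξ a) b) hch lam (by
    intro a ha
    have h1 := hDs a ha
    have h2 := trace_mul_re_nonneg (hrest a) (hdens a).1
    simp only [measProb, hM]
    rw [Matrix.add_mul, Matrix.trace_add, Complex.add_re]
    linarith)
  let e := (Fintype.equivFin (Fin n → A)).symm
  refine ⟨n, _, Fintype.card (Fin n → A), fun c => M (e c), hQ, ⟨fun c => hMP.1 _, ?_⟩, ?_⟩
  · rw [← hMP.2]
    exact e.sum_comp M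
  · have h3 := miJoint_reindex e (fun a b => (if a ∈ C then (C.card : ℝ)⁻¹ else 0) *
      measProb M (tensPow ξ a) b)
    have h4 : (miJoint fun (a : Fin n → A) c => (if a ∈ C then (C.card : ℝ)⁻¹ else 0) *
      measProb (fun c => M (e c)) (tensPow ξ a) c) = _ := h3
    rw [h4]
    refine lt_of_mul_lt_mul_right (lt_of_lt_of_le ?_ hmi) log2_pos.le
    have hlog : Real.log (lam / 12) + n * (Δ - 2 * (g / 8)) ≤ Real.log C.card := by
      have := Real.log_le_log (by positivity) hC
      rwa [Real.log_mul (by positivity) (Real.exp_pos _).ne', Real.log_exp] at this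
    have h5 := mul_le_mul_of_nonneg_left hlog (show 0 ≤ 1 - lam by linarith)
    have h6 : (n : ℝ) * (R' + g / 2) ≤ (1 - lam) * (n * (Δ - 2 * (g / 8))) := by
      have : R' + g / 2 ≤ (1 - lam) * (Δ - 2 * (g / 8)) := by nlinarith
      calc (n : ℝ) * (R' + g / 2) ≤ n * ((1 - lam) * (Δ - 2 * (g / 8))) :=
            mul_le_mul_of_nonneg_left this (Nat.cast_nonneg n)
        _ = _ := by ring
    have h7 : (n : ℝ) * R * Real.log 2 = n * R' := by rw [hR']; ring
    rw [h7]
    linarith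

end Coding

/-- **Entangled measurements eventually beat individual ones.** If the maximal
Holevo quantity of Bob's ensemble exceeds Eve's single-copy accessible
information, `C(ξ_B) > C₁(ξ_E)`, then for some number of copies `n` the supremum
of the mutual information over arbitrary (possibly entangled) POVMs on Bob's `n`
copies strictly exceeds the supremum over factorized POVMs `M₁ ⊗ ⋯ ⊗ M_n` on
Eve's `n` copies. -/
theorem entangled_beats_factorized
    {A : Type*} [Fintype A] [Nonempty A] {dB dE : ℕ}
    (ξB : A → Matrix (Fin dB) (Fin dB) ℂ) (hξB : ∀ a, IsDensity (ξB a))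
    (ξE : A → Matrix (Fin dE) (Fin dE) ℂ) (hξE : ∀ a, IsDensity (ξE a))
    (hgap : sSup (accInfoSet ξE) < sSup (holevoSet ξB)) :
    ∃ n : ℕ,
      sSup { x : ℝ | ∃ (P : (Fin n → A) → ℝ) (m : Fin n → ℕ)
          (M : (i : Fin n) → Fin (m i) → Matrix (Fin dE) (Fin dE) ℂ),
          IsProbDist P ∧ (∀ i, IsPOVM (M i)) ∧
          x = miJoint (fun (a : Fin n → A) (e : (i : Fin n) → Fin (m i)) =>
            P a * ((Matrix.of (fun v w : Fin n → Fin dE =>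
              ∏ i, M i (e i) (v i) (w i)) * tensPow ξE a).trace).re) }
      < sSup { x : ℝ | ∃ (P : (Fin n → A) → ℝ) (m : ℕ)
          (M : Fin m → Matrix (Fin n → Fin dB) (Fin n → Fin dB) ℂ),
          IsProbDist P ∧ IsPOVM M ∧
          x = miJoint (fun a b => P a * measProb M (tensPow ξB a) b) } := by
  classical
  set C₁ := sSup (accInfoSet ξE) with hC₁
  have hbdd : BddAbove (accInfoSet ξE) := by
    refine ⟨(Fintype.card A : ℝ) / Real.log 2, ?_⟩
    rintro x ⟨P, m, M, hP, hM, rfl⟩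
    exact mi_upper P _ hP (meas_channel ξE hξE M hM)
  have hC₁0 : 0 ≤ C₁ := by
    refine Real.sSup_nonneg ?_
    rintro x ⟨P, m, M, hP, hM, rfl⟩
    exact mi_nonneg P _ hP (meas_channel ξE hξE M hM)
  have hne : (holevoSet ξB).Nonempty := by
    obtain ⟨a₀⟩ := ‹Nonempty A›
    exact ⟨_, fun a => if a = a₀ then 1 else 0,
      ⟨fun a => by dsimp only; split_ifs <;> norm_num, by simp⟩, rfl⟩
  obtain ⟨x, ⟨P, hP, rfl⟩, hx⟩ := exists_lt_of_lt_csSup hne hgap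
  obtain ⟨n, Q, m, M, hQ, hM, hmi⟩ := achieve P hP ξB hξB C₁ hC₁0 hx
  refine ⟨n, ?_⟩
  refine lt_of_le_of_lt (Real.sSup_le ?_ (mul_nonneg (Nat.cast_nonneg n) hC₁0))
    (lt_of_lt_of_le hmi (le_csSup ?_ ⟨Q, m, M, hQ, hM, rfl⟩))
  · rintro y ⟨P', m', M', hP', hM', rfl⟩
    have hV : ∀ i, IsChannel (fun a b => measProb (M' i) (ξE a) b) := fun i =>
      meas_channel ξE hξE (M' i) (hM' i)
    obtain ⟨hpm, hle⟩ := mi_product_le P' hP' (fun i a b => measProb (M' i) (ξE a) b) hV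
    have e : ∀ (a : Fin n → A) (e : (i : Fin n) → Fin (m' i)),
        ((Matrix.of (fun v w : Fin n → Fin dE => ∏ i, M' i (e i) (v i) (w i)) *
          tensPow ξE a).trace).re = ∏ i, measProb (M' i) (ξE (a i)) (e i) := by
      intro a e
      have h1 : Matrix.of (fun v w : Fin n → Fin dE => ∏ i, M' i (e i) (v i) (w i)) =
        tens (fun i => M' i (e i)) := rfl
      rw [h1, tensPow_eq, tens_mul, tens_trace]
      have h2 : ∀ i, (M' i (e i) * ξE (a i)).trace = (measProb (M' i) (ξE (a i)) (e i) : ℂ) :=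
        fun i => trace_mul_ofReal ((hM' i).1 _) (hξE _).1
      simp only [h2]
      rw [← Complex.ofReal_prod, Complex.ofReal_re]
    simp only [e]
    refine hle.trans ?_
    refine (Finset.sum_le_sum fun i _ => le_csSup hbdd ⟨_, m' i, M' i, hpm i, hM' i, rfl⟩).trans ?_
    simp [hC₁]
  · refine ⟨(Fintype.card (Fin n → A) : ℝ) / Real.log 2, ?_⟩
    rintro x ⟨P', m', M', hP', hM', rfl⟩
    exact mi_upper P' _ hP' (meas_channel (fun a => tensPow ξB a)
      (fun a => tens_density _ fun i => hξB (a i)) M' hM')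

end QKD
end
end

section
/- Let A be a finite set, d ∈ ℕ, P a probability distribution on A, and ξ : A → density matrices on ℂ^d. Then for every finite set B and every POVM {M(b)}_{b∈B} on ℂ^d, the Shannon mutual information between input a ~ P and the outcome b of measuring ξ(a) with {M(b)} is at most the Holevo quantity χ(P,ξ) = H(Σ_a P(a)ξ(a)) − Σ_a P(a)H(ξ(a)). -/
open scoped BigOperators ComplexOrder

noncomputable section

namespace QKD

lemma term_cont (p q : ℝ) (hp : 0 ≤ p) (hq : 0 ≤ q) (h : q = 0 → p = 0) :
    ContinuousOn (fun t : ℝ => p * Real.log (q + t * (p - q)) - t * (p - q)) (Set.Icc 0 1) := by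
  rcases hp.eq_or_lt with h0 | h0
  · subst h0
    simp only [zero_mul]
    fun_prop
  · have hq0 : 0 < q := lt_of_le_of_ne hq (fun e => h0.ne' (h e.symm))
    apply ContinuousOn.sub _ (by fun_prop)
    apply ContinuousOn.mul (by fun_prop)
    apply ContinuousOn.log (by fun_prop)
    intro t ht
    have : 0 < q + t * (p - q) := by
      have h1 := ht.1
      have h2 := ht.2
      have : q + t * (p - q) = (1 - t) * q + t * p := by ring
      rw [this]
      rcases h1.eq_or_lt with e | e
      · subst e; simpa using hq0
      · have := mul_pos e h0
        have := mul_nonneg (sub_nonneg.2 h2) hq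
        linarith
    exact this.ne'

lemma term_deriv (p q : ℝ) (hp : 0 ≤ p) (hq : 0 ≤ q) (h : q = 0 → p = 0) (t : ℝ)
    (ht : t ∈ Set.Ioo (0:ℝ) 1) :
    HasDerivAt (fun t : ℝ => p * Real.log (q + t * (p - q)) - t * (p - q))
      ((1 - t) * ((p - q) ^ 2 / (t * p + (1 - t) * q))) t := by
  rcases hq.eq_or_lt with h0 | h0
  · subst h0
    have := h rfl
    subst this
    simp
    exact hasDerivAt_const t 0
  · have hpos : 0 < q + t * (p - q) := by
      have : q + t * (p - q) = (1 - t) * q + t * p := by ring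
      rw [this]
      have := mul_pos (sub_pos.2 ht.2) h0
      have := mul_nonneg ht.1.le hp
      linarith
    have h1 : HasDerivAt (fun t : ℝ => q + t * (p - q)) (p - q) t := by
      simpa using ((hasDerivAt_id t).mul_const (p - q)).const_add q
    have h2 : HasDerivAt (fun t : ℝ => t * (p - q)) (p - q) t := by
      simpa using ((hasDerivAt_id t).mul_const (p - q))
    have h3 := ((h1.log hpos.ne').const_mul p).sub h2
    have e0 : p * ((p - q) / (q + t * (p - q))) - (p - q) =
        (1 - t) * ((p - q) ^ 2 / (q + t * (p - q))) := by
      have hne := hpos.ne'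
      generalize hu : q + t * (p - q) = u at hne
      have e1 : p * (p - q) - (p - q) * u = (1 - t) * (p - q) ^ 2 := by rw [← hu]; ring
      rw [← mul_div_assoc, ← mul_div_assoc, ← e1, sub_div, mul_div_cancel_right₀ _ hne]
    have e : t * p + (1 - t) * q = q + t * (p - q) := by ring
    rw [e, ← e0]
    exact h3

lemma scalar_compare {K B : Type*} [Fintype K] [Fintype B] (p q : K → ℝ) (m n : B → ℝ)
    (hp : ∀ k, 0 ≤ p k) (hq : ∀ k, 0 ≤ q k) (h : ∀ k, q k = 0 → p k = 0)
    (hm : ∀ k, 0 ≤ m k) (hn : ∀ k, 0 ≤ n k) (h' : ∀ k, n k = 0 → m k = 0)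
    (key : ∀ t ∈ Set.Ioo (0:ℝ) 1, ∑ b, (m b - n b) ^ 2 / (t * m b + (1 - t) * n b) ≤
      ∑ k, (p k - q k) ^ 2 / (t * p k + (1 - t) * q k)) :
    ∑ b, (m b * Real.log (m b) - m b * Real.log (n b) - m b + n b) ≤
    ∑ k, (p k * Real.log (p k) - p k * Real.log (q k) - p k + q k) := by
  let F : ℝ → ℝ := fun t =>
    (∑ k, (p k * Real.log (q k + t * (p k - q k)) - t * (p k - q k))) -
    ∑ b, (m b * Real.log (n b + t * (m b - n b)) - t * (m b - n b))
  have hd : ∀ t ∈ Set.Ioo (0:ℝ) 1, HasDerivAt F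
      ((∑ k, (1 - t) * ((p k - q k) ^ 2 / (t * p k + (1 - t) * q k))) -
       ∑ k, (1 - t) * ((m k - n k) ^ 2 / (t * m k + (1 - t) * n k))) t := by
    intro t ht
    apply HasDerivAt.sub
    · exact HasDerivAt.fun_sum fun k _ => term_deriv _ _ (hp k) (hq k) (h k) t ht
    · exact HasDerivAt.fun_sum fun k _ => term_deriv _ _ (hm k) (hn k) (h' k) t ht
  have hmono : MonotoneOn F (Set.Icc 0 1) := by
    apply monotoneOn_of_deriv_nonneg (convex_Icc 0 1)
    · apply ContinuousOn.sub
      · exact continuousOn_finsetSum _ fun k _ => term_cont _ _ (hp k) (hq k) (h k)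
      · exact continuousOn_finsetSum _ fun k _ => term_cont _ _ (hm k) (hn k) (h' k)
    · rw [interior_Icc]
      exact fun t ht => (hd t ht).differentiableAt.differentiableWithinAt
    · rw [interior_Icc]
      intro t ht
      rw [(hd t ht).deriv, ← Finset.mul_sum, ← Finset.mul_sum, ← mul_sub]
      exact mul_nonneg (sub_nonneg.2 ht.2.le) (sub_nonneg.2 (key t ht))
  have := hmono (Set.left_mem_Icc.2 zero_le_one) (Set.right_mem_Icc.2 zero_le_one) zero_le_one
  simp only [F, zero_mul, add_zero, Finset.sum_const_zero, one_mul, add_sub_cancel,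
    Finset.sum_sub_distrib] at this
  simp only [Finset.sum_sub_distrib, Finset.sum_add_distrib]
  linarith

open Matrix MatrixOrder in
lemma trace_mul_nonneg' {d : ℕ} {A B : Matrix (Fin d) (Fin d) ℂ} (hA : A.PosSemidef)
    (hB : B.PosSemidef) : 0 ≤ (A * B).trace.re := by
  obtain ⟨C, rfl⟩ := CStarAlgebra.nonneg_iff_eq_star_mul_self.mp hB.nonneg
  rw [star_eq_conjTranspose]
  have h := (hA.mul_mul_conjTranspose_same C).trace_nonneg
  have e : (A * (Cᴴ * C)).trace = (C * A * Cᴴ).trace := by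
    rw [← Matrix.mul_assoc, Matrix.trace_mul_comm, Matrix.mul_assoc]
  rw [e]
  exact (Complex.le_def.1 h).1

open Matrix in
lemma kadison {d : ℕ} {B : Type*} [Fintype B] (M : B → Matrix (Fin d) (Fin d) ℂ)
    (hM : ∀ b, (M b).PosSemidef) (h1 : ∑ b, M b = 1) (x : B → ℝ) :
    (∑ b, ((x b : ℂ) ^ 2) • M b - (∑ b, (x b : ℂ) • M b) * (∑ b, (x b : ℂ) • M b)).PosSemidef := by
  set X := ∑ b, (x b : ℂ) • M b with hX
  have hXh : Xᴴ = X := by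
    rw [hX, conjTranspose_sum]
    refine Finset.sum_congr rfl fun b _ => ?_
    rw [conjTranspose_smul, (hM b).1.eq]
    simp
  have h : ∀ b, ((((x b : ℂ) • (1 : Matrix (Fin d) (Fin d) ℂ) - X)) * M b *
      ((x b : ℂ) • (1 : Matrix (Fin d) (Fin d) ℂ) - X)ᴴ).PosSemidef :=
    fun b => (hM b).mul_mul_conjTranspose_same _
  have hs := Matrix.posSemidef_sum Finset.univ (fun b _ => h b)
  convert hs using 1
  have e : ∀ b, (((x b : ℂ) • (1 : Matrix (Fin d) (Fin d) ℂ) - X)) * M b *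
      ((x b : ℂ) • (1 : Matrix (Fin d) (Fin d) ℂ) - X)ᴴ =
      ((x b : ℂ) ^ 2) • M b - ((x b : ℂ) • M b) * X - X * ((x b : ℂ) • M b) + X * M b * X := by
    intro b
    rw [conjTranspose_sub, hXh, conjTranspose_smul]
    have e0 : star (x b : ℂ) = (x b : ℂ) := by simp
    rw [e0, conjTranspose_one]
    generalize (x b : ℂ) = z
    simp only [Matrix.sub_mul, Matrix.mul_sub, pow_two, Matrix.smul_mul, Matrix.mul_smul,
      Matrix.one_mul, Matrix.mul_one, smul_sub, smul_smul]
    abel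
  rw [Finset.sum_congr rfl fun b _ => e b, Finset.sum_add_distrib, Finset.sum_sub_distrib,
    Finset.sum_sub_distrib, ← Finset.sum_mul, ← Finset.mul_sum, ← Finset.sum_mul,
    ← Finset.mul_sum, h1, ← hX]
  simp

open Matrix in
lemma tr_left {d : ℕ} (Y W : Matrix (Fin d) (Fin d) ℂ) (p : Fin d → ℝ) :
    (Y * Wᴴ * diagonal (fun i => (p i : ℂ))).trace.re =
      ∑ k : Fin d × Fin d, p k.1 * (Y k.1 k.2 * star (W k.1 k.2)).re := by
  rw [Fintype.sum_prod_type]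
  rw [Matrix.trace, Complex.re_sum]
  refine Finset.sum_congr rfl fun i _ => ?_
  rw [Matrix.diag_apply, Matrix.mul_diagonal, Matrix.mul_apply]
  simp only [Matrix.conjTranspose_apply]
  rw [mul_comm, Complex.re_ofReal_mul, Complex.re_sum, Finset.mul_sum]

open Matrix in
lemma tr_right {d : ℕ} (Y W : Matrix (Fin d) (Fin d) ℂ) (p : Fin d → ℝ) :
    (Y * diagonal (fun i => (p i : ℂ)) * Wᴴ).trace.re =
      ∑ k : Fin d × Fin d, p k.2 * (Y k.1 k.2 * star (W k.1 k.2)).re := by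
  rw [Fintype.sum_prod_type]
  rw [Matrix.trace, Complex.re_sum]
  refine Finset.sum_congr rfl fun i _ => ?_
  rw [Matrix.diag_apply, Matrix.mul_apply, Complex.re_sum]
  refine Finset.sum_congr rfl fun j _ => ?_
  rw [Matrix.mul_diagonal, Matrix.conjTranspose_apply]
  rw [mul_comm (Y i j), mul_assoc, Complex.re_ofReal_mul]

lemma term_bound (w y : ℂ) (p r t : ℝ) (hp : 0 ≤ p) (hr : 0 ≤ r) (ht : t ∈ Set.Ioo (0:ℝ) 1) :
    2 * ((p - r) * (y * star w).re) - (t * p + (1 - t) * r) * (y * star y).re ≤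
    (Complex.normSq w * p - Complex.normSq w * r) ^ 2 /
      (t * (Complex.normSq w * p) + (1 - t) * (Complex.normSq w * r)) := by
  have hy : (y * star y).re = Complex.normSq y := by
    simp [Complex.normSq_apply]
  have hT : 0 ≤ t * p + (1 - t) * r :=
    add_nonneg (mul_nonneg ht.1.le hp) (mul_nonneg (sub_nonneg.2 ht.2.le) hr)
  have hcs : (y * star w).re ^ 2 ≤ Complex.normSq y * Complex.normSq w := by
    have h := Complex.re_sq_le_normSq (y * star w)
    rw [Complex.normSq_mul] at h
    simpa [pow_two] using h
  rw [hy]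
  set s := (y * star w).re
  have hny := Complex.normSq_nonneg y
  set Y := Complex.normSq y
  rcases (Complex.normSq_nonneg w).eq_or_lt with h0 | h0
  · rw [← h0] at hcs ⊢
    have : s = 0 := by nlinarith
    rw [this]
    simp
    positivity
  · set N := Complex.normSq w
    rcases hT.eq_or_lt with h1 | h1
    · have a1 := mul_nonneg ht.1.le hp
      have a2 := mul_nonneg (sub_nonneg.2 ht.2.le) hr
      have b1 : t * p = 0 := by linarith
      have b2 : (1 - t) * r = 0 := by linarith
      have c1 : p = 0 := by
        rcases mul_eq_zero.1 b1 with h | h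
        · exact absurd h ht.1.ne'
        · exact h
      have c2 : r = 0 := by
        rcases mul_eq_zero.1 b2 with h | h
        · exact absurd h (sub_pos.2 ht.2).ne'
        · exact h
      simp [c1, c2]
    · have e : (N * p - N * r) ^ 2 / (t * (N * p) + (1 - t) * (N * r)) =
          N * (p - r) ^ 2 / (t * p + (1 - t) * r) := by
        have : t * (N * p) + (1 - t) * (N * r) = N * (t * p + (1 - t) * r) := by ring
        rw [this]
        field_simp
      rw [e, le_div_iff₀ h1]
      set T := t * p + (1 - t) * r
      -- N * LHS ≤ N * RHS
      have hh : N * ((2 * ((p - r) * s) - T * Y) * T) ≤ N * (N * (p - r) ^ 2) := by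
        nlinarith [sq_nonneg (N * (p - r) - T * s), mul_le_mul_of_nonneg_left hcs (sq_nonneg T)]
      exact le_of_mul_le_mul_left hh h0

open Matrix in
lemma key_ineq {d : ℕ} {B : Type*} [Fintype B] (M : B → Matrix (Fin d) (Fin d) ℂ)
    (hM : ∀ b, (M b).PosSemidef) (h1 : ∑ b, M b = 1)
    (U V : Matrix (Fin d) (Fin d) ℂ) (hU : U * Uᴴ = 1) (hV : V * Vᴴ = 1)
    (p r : Fin d → ℝ) (hp : ∀ i, 0 ≤ p i) (hr : ∀ i, 0 ≤ r i)
    (σ ρ : Matrix (Fin d) (Fin d) ℂ) (hσp : σ.PosSemidef) (hρp : ρ.PosSemidef)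
    (hσ : σ = U * diagonal (fun i => (p i : ℂ)) * Uᴴ)
    (hρ : ρ = V * diagonal (fun i => (r i : ℂ)) * Vᴴ)
    (t : ℝ) (ht : t ∈ Set.Ioo (0:ℝ) 1) :
    ∑ b, ((M b * σ).trace.re - (M b * ρ).trace.re) ^ 2 /
        (t * (M b * σ).trace.re + (1 - t) * (M b * ρ).trace.re) ≤
    ∑ k : Fin d × Fin d, (Complex.normSq ((Uᴴ * V) k.1 k.2) * p k.1 -
        Complex.normSq ((Uᴴ * V) k.1 k.2) * r k.2) ^ 2 /
      (t * (Complex.normSq ((Uᴴ * V) k.1 k.2) * p k.1) +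
        (1 - t) * (Complex.normSq ((Uᴴ * V) k.1 k.2) * r k.2)) := by
  set m : B → ℝ := fun b => (M b * σ).trace.re with hm
  set n : B → ℝ := fun b => (M b * ρ).trace.re with hn
  set x : B → ℝ := fun b => (m b - n b) / (t * m b + (1 - t) * n b) with hx
  set X := ∑ b, (x b : ℂ) • M b with hX
  set W := Uᴴ * V with hW
  set Y := Uᴴ * X * V with hY
  have hXh : Xᴴ = X := by
    rw [hX, conjTranspose_sum]
    refine Finset.sum_congr rfl fun b _ => ?_
    rw [conjTranspose_smul, (hM b).1.eq]
    simp
  have hWh : Wᴴ = Vᴴ * U := by simp [hW]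
  have hYh : Yᴴ = Vᴴ * X * U := by simp [hY, hXh, Matrix.mul_assoc]
  have hlin : ∀ (c : B → ℝ) (τ : Matrix (Fin d) (Fin d) ℂ),
      ((∑ b, (c b : ℂ) • M b) * τ).trace.re = ∑ b, c b * (M b * τ).trace.re := by
    intro c τ
    simp [Finset.sum_mul, Matrix.trace_sum]
  have q1 : (X * σ).trace.re = ∑ k : Fin d × Fin d, p k.1 * (Y k.1 k.2 * star (W k.1 k.2)).re := by
    rw [← tr_left, hWh, hY, hσ]
    congr 1
    calc _ = (X * (V * Vᴴ) * U * diagonal (fun i => (p i : ℂ)) * Uᴴ).trace := by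
            rw [hV]; simp [Matrix.mul_assoc]
      _ = _ := by rw [Matrix.trace_mul_comm]; simp only [Matrix.mul_assoc]
  have q2 : (X * ρ).trace.re = ∑ k : Fin d × Fin d, r k.2 * (Y k.1 k.2 * star (W k.1 k.2)).re := by
    rw [← tr_right, hWh, hY, hρ]
    congr 1
    calc _ = (U * Uᴴ * X * V * diagonal (fun i => (r i : ℂ)) * Vᴴ).trace := by
            rw [hU]; simp [Matrix.mul_assoc]
      _ = _ := by
            rw [Matrix.mul_assoc U, Matrix.mul_assoc U, Matrix.mul_assoc U, Matrix.mul_assoc U,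
              Matrix.trace_mul_comm]
            simp only [Matrix.mul_assoc]
  have q3 : (X * X * σ).trace.re =
      ∑ k : Fin d × Fin d, p k.1 * (Y k.1 k.2 * star (Y k.1 k.2)).re := by
    rw [← tr_left, hYh, hY, hσ]
    congr 1
    calc _ = (X * (V * Vᴴ) * X * U * diagonal (fun i => (p i : ℂ)) * Uᴴ).trace := by
            rw [hV]; simp [Matrix.mul_assoc]
      _ = _ := by rw [Matrix.trace_mul_comm]; simp only [Matrix.mul_assoc]
  have q4 : (X * X * ρ).trace.re =
      ∑ k : Fin d × Fin d, r k.2 * (Y k.1 k.2 * star (Y k.1 k.2)).re := by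
    rw [← tr_right, hYh, hY, hρ]
    congr 1
    calc _ = (X * (U * Uᴴ) * X * V * diagonal (fun i => (r i : ℂ)) * Vᴴ).trace := by
            rw [hU]; simp [Matrix.mul_assoc]
      _ = ((X * U) * (Uᴴ * X * V * diagonal (fun i => (r i : ℂ)) * Vᴴ)).trace := by
            simp only [Matrix.mul_assoc]
      _ = _ := by rw [Matrix.trace_mul_comm]; simp only [Matrix.mul_assoc]
  have hk := kadison M hM h1 x
  have hkk : ∀ τ : Matrix (Fin d) (Fin d) ℂ, τ.PosSemidef →
      (X * X * τ).trace.re ≤ ∑ b, x b ^ 2 * (M b * τ).trace.re := by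
    intro τ hτ
    have h := trace_mul_nonneg' hk hτ
    rw [Matrix.sub_mul, Matrix.trace_sub, Complex.sub_re] at h
    have h2 := hlin (fun b => x b ^ 2) τ
    push_cast at h2
    rw [h2] at h
    linarith
  have kσ := hkk σ hσp
  have kρ := hkk ρ hρp
  have hU0 : ∀ b, 0 ≤ m b := fun b => trace_mul_nonneg' (hM b) hσp
  have hU1 : ∀ b, 0 ≤ n b := fun b => trace_mul_nonneg' (hM b) hρp
  have eb : ∀ b, (m b - n b) ^ 2 / (t * m b + (1 - t) * n b) =
      2 * (x b * m b - x b * n b) - (t * (x b ^ 2 * m b) + (1 - t) * (x b ^ 2 * n b)) := by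
    intro b
    have : t * (x b ^ 2 * m b) + (1 - t) * (x b ^ 2 * n b) =
      x b ^ 2 * (t * m b + (1 - t) * n b) := by ring
    rw [this]
    by_cases h : t * m b + (1 - t) * n b = 0
    · simp [hx, h]
    · simp only [hx]
      field_simp
      ring
  have tot : ∑ b, (m b - n b) ^ 2 / (t * m b + (1 - t) * n b) =
      2 * ((X * σ).trace.re - (X * ρ).trace.re) -
        (t * (∑ b, x b ^ 2 * m b) + (1 - t) * ∑ b, x b ^ 2 * n b) := by
    rw [Finset.sum_congr rfl fun b _ => eb b, hX, hlin, hlin]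
    simp only [Finset.sum_sub_distrib, Finset.sum_add_distrib, ← Finset.mul_sum]
    rfl
  have fin1 := Finset.sum_le_sum fun k (_ : k ∈ (Finset.univ : Finset (Fin d × Fin d))) =>
    term_bound (W k.1 k.2) (Y k.1 k.2) (p k.1) (r k.2) t (hp _) (hr _) ht
  refine le_trans ?_ fin1
  rw [tot]
  have s1 := mul_le_mul_of_nonneg_left kσ ht.1.le
  have s2 := mul_le_mul_of_nonneg_left kρ (sub_nonneg.2 ht.2.le)
  have e2 : ∑ k : Fin d × Fin d, (2 * ((p k.1 - r k.2) * (Y k.1 k.2 * star (W k.1 k.2)).re) -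
      (t * p k.1 + (1 - t) * r k.2) * (Y k.1 k.2 * star (Y k.1 k.2)).re) =
      2 * ((X * σ).trace.re - (X * ρ).trace.re) -
      (t * (X * X * σ).trace.re + (1 - t) * (X * X * ρ).trace.re) := by
    rw [q1, q2, q3, q4]
    simp only [Finset.mul_sum, ← Finset.sum_sub_distrib, ← Finset.sum_add_distrib]
    exact Finset.sum_congr rfl fun k _ => by ring
  rw [e2]
  change _ ≤ _
  simp only [hm, hn] at s1 s2 ⊢
  linarith

open Matrix in
lemma row_norm {d : ℕ} (W : Matrix (Fin d) (Fin d) ℂ) (hW : W * Wᴴ = 1) (i : Fin d) :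
    ∑ j, Complex.normSq (W i j) = 1 := by
  have h := congrFun (congrFun hW i) i
  rw [Matrix.mul_apply, Matrix.one_apply_eq] at h
  have h2 := congrArg Complex.re h
  rw [Complex.re_sum] at h2
  rw [Complex.one_re] at h2
  rw [← h2]
  exact Finset.sum_congr rfl fun j _ => by simp [Complex.normSq_apply]

open Matrix in
lemma col_norm {d : ℕ} (W : Matrix (Fin d) (Fin d) ℂ) (hW : Wᴴ * W = 1) (j : Fin d) :
    ∑ i, Complex.normSq (W i j) = 1 := by
  have h := row_norm Wᴴ (by simpa using hW) j
  simpa using h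

open Matrix in
lemma diag_conj {d : ℕ} (W : Matrix (Fin d) (Fin d) ℂ) (p : Fin d → ℝ) (j : Fin d) :
    ((Wᴴ * diagonal (fun i => (p i : ℂ)) * W) j j).re = ∑ i, Complex.normSq (W i j) * p i := by
  rw [Matrix.mul_apply, Complex.re_sum]
  refine Finset.sum_congr rfl fun i _ => ?_
  rw [Matrix.mul_diagonal, Matrix.conjTranspose_apply]
  simp [Complex.normSq_apply]
  ring

open Matrix in
lemma meas_rel {d : ℕ} {B : Type*} [Fintype B] (M : B → Matrix (Fin d) (Fin d) ℂ)
    (hM : ∀ b, (M b).PosSemidef) (h1 : ∑ b, M b = 1)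
    (U V : Matrix (Fin d) (Fin d) ℂ) (hU : U * Uᴴ = 1) (hV : V * Vᴴ = 1)
    (p r : Fin d → ℝ) (hp : ∀ i, 0 ≤ p i) (hr : ∀ i, 0 ≤ r i)
    (σ ρ : Matrix (Fin d) (Fin d) ℂ) (hσp : σ.PosSemidef) (hρp : ρ.PosSemidef)
    (hσ : σ = U * diagonal (fun i => (p i : ℂ)) * Uᴴ)
    (hρ : ρ = V * diagonal (fun i => (r i : ℂ)) * Vᴴ)
    (c : ℝ) (hc : 0 < c) (hsub : (ρ - (c : ℂ) • σ).PosSemidef) :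
    ∑ b, ((M b * σ).trace.re * Real.log (M b * σ).trace.re -
      (M b * σ).trace.re * Real.log (M b * ρ).trace.re) ≤
    ∑ i, p i * Real.log (p i) - ∑ j, Real.log (r j) * ((Vᴴ * σ * V) j j).re := by
  have hU' : Uᴴ * U = 1 := mul_eq_one_comm.1 hU
  have hV' : Vᴴ * V = 1 := mul_eq_one_comm.1 hV
  have hm0 : ∀ b, 0 ≤ (M b * σ).trace.re := fun b => trace_mul_nonneg' (hM b) hσp
  have hn0 : ∀ b, 0 ≤ (M b * ρ).trace.re := fun b => trace_mul_nonneg' (hM b) hρp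
  have hmn : ∀ b, (M b * ρ).trace.re = 0 → (M b * σ).trace.re = 0 := by
    intro b hb
    have h := trace_mul_nonneg' (hM b) hsub
    rw [Matrix.mul_sub, Matrix.trace_sub, Complex.sub_re, hb, Matrix.mul_smul,
      Matrix.trace_smul, smul_eq_mul, Complex.re_ofReal_mul] at h
    nlinarith [hm0 b]
  set W := Uᴴ * V with hW
  have hWh : Wᴴ = Vᴴ * U := by simp [hW]
  have hW1 : W * Wᴴ = 1 := by
    rw [hWh, hW, Matrix.mul_assoc, ← Matrix.mul_assoc V, hV, Matrix.one_mul, hU']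
  have hW2 : Wᴴ * W = 1 := mul_eq_one_comm.1 hW1
  have hs : ∀ j, ((Vᴴ * σ * V) j j).re = ∑ i, Complex.normSq (W i j) * p i := by
    intro j
    rw [← diag_conj, hWh, hW, hσ]
    simp only [Matrix.mul_assoc]
  have hrr : ∀ j, ((Vᴴ * ρ * V) j j).re = r j := by
    intro j
    have : Vᴴ * ρ * V = diagonal (fun i => (r i : ℂ)) := by
      rw [hρ]
      calc _ = (Vᴴ * V) * diagonal (fun i => (r i : ℂ)) * (Vᴴ * V) := by
            simp only [Matrix.mul_assoc]
        _ = _ := by rw [hV']; simp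
    rw [this]
    simp
  have hle : ∀ j, c * ∑ i, Complex.normSq (W i j) * p i ≤ r j := by
    intro j
    have h := (hsub.conjTranspose_mul_mul_same V).diag_nonneg (i := j)
    have h2 := (Complex.le_def.1 h).1
    rw [Matrix.mul_sub, Matrix.sub_mul, Matrix.sub_apply, Complex.sub_re, hrr,
      Matrix.mul_smul, Matrix.smul_mul, Matrix.smul_apply, smul_eq_mul, Complex.re_ofReal_mul,
      hs] at h2
    simpa using h2
  have hterm0 : ∀ i j, 0 ≤ Complex.normSq (W i j) * p i :=
    fun i j => mul_nonneg (Complex.normSq_nonneg _) (hp i)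
  have hz : ∀ i j, r j = 0 → Complex.normSq (W i j) * p i = 0 := by
    intro i j h
    have h3 := hle j
    rw [h] at h3
    have h4 := Finset.single_le_sum (f := fun i => Complex.normSq (W i j) * p i)
      (fun i _ => hterm0 i j) (Finset.mem_univ i)
    have h5 := hterm0 i j
    try simp only at h4
    nlinarith
  have main := scalar_compare
    (fun k : Fin d × Fin d => Complex.normSq (W k.1 k.2) * p k.1)
    (fun k : Fin d × Fin d => Complex.normSq (W k.1 k.2) * r k.2)
    (fun b => (M b * σ).trace.re) (fun b => (M b * ρ).trace.re)
    (fun k => hterm0 _ _) (fun k => mul_nonneg (Complex.normSq_nonneg _) (hr _))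
    (fun k hk => by
      rcases mul_eq_zero.1 hk with h | h
      · simp [h]
      · exact hz _ _ h) hm0 hn0 hmn
    (fun t ht => key_ineq M hM h1 U V hU hV p r hp hr σ ρ hσp hρp hσ hρ t ht)
  have hsum : ∀ τ : Matrix (Fin d) (Fin d) ℂ, ∑ b, (M b * τ).trace.re = τ.trace.re := by
    intro τ
    rw [← Complex.re_sum, ← Matrix.trace_sum, ← Finset.sum_mul, h1, Matrix.one_mul]
  have htrs : σ.trace.re = ∑ i, p i := by
    rw [hσ, Matrix.trace_mul_comm, ← Matrix.mul_assoc, hU']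
    simp [Matrix.trace]
  have htrr : ρ.trace.re = ∑ i, r i := by
    rw [hρ, Matrix.trace_mul_comm, ← Matrix.mul_assoc, hV']
    simp [Matrix.trace]
  have hNp : ∑ k : Fin d × Fin d, Complex.normSq (W k.1 k.2) * p k.1 = ∑ i, p i := by
    rw [Fintype.sum_prod_type]
    refine Finset.sum_congr rfl fun i _ => ?_
    simp only
    rw [← Finset.sum_mul, row_norm W hW1, one_mul]
  have hNr : ∑ k : Fin d × Fin d, Complex.normSq (W k.1 k.2) * r k.2 = ∑ i, r i := by
    rw [Fintype.sum_prod_type_right]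
    refine Finset.sum_congr rfl fun i _ => ?_
    simp only
    rw [← Finset.sum_mul, col_norm W hW2, one_mul]
  have hlog : ∀ k : Fin d × Fin d,
      Complex.normSq (W k.1 k.2) * p k.1 * Real.log (Complex.normSq (W k.1 k.2) * p k.1) -
      Complex.normSq (W k.1 k.2) * p k.1 * Real.log (Complex.normSq (W k.1 k.2) * r k.2) =
      Complex.normSq (W k.1 k.2) * (p k.1 * Real.log (p k.1)) -
      Complex.normSq (W k.1 k.2) * p k.1 * Real.log (r k.2) := by
    intro k
    by_cases hN : Complex.normSq (W k.1 k.2) = 0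
    · simp [hN]
    by_cases hp0 : p k.1 = 0
    · simp [hp0]
    by_cases hr0 : r k.2 = 0
    · have := hz k.1 k.2 hr0
      exact absurd this (mul_ne_zero hN hp0)
    rw [Real.log_mul hN hp0, Real.log_mul hN hr0]
    ring
  have hA : ∑ k : Fin d × Fin d, Complex.normSq (W k.1 k.2) * (p k.1 * Real.log (p k.1)) =
      ∑ i, p i * Real.log (p i) := by
    rw [Fintype.sum_prod_type]
    refine Finset.sum_congr rfl fun i _ => ?_
    simp only
    rw [← Finset.sum_mul, row_norm W hW1, one_mul]
  have hB : ∑ k : Fin d × Fin d, Complex.normSq (W k.1 k.2) * p k.1 * Real.log (r k.2) =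
      ∑ j, Real.log (r j) * ((Vᴴ * σ * V) j j).re := by
    rw [Fintype.sum_prod_type_right]
    refine Finset.sum_congr rfl fun j _ => ?_
    simp only
    rw [← Finset.sum_mul, hs, mul_comm]
  rw [← hA, ← hB, ← Finset.sum_sub_distrib, ← Finset.sum_congr rfl fun k _ => hlog k]
  rw [Finset.sum_add_distrib, Finset.sum_sub_distrib, Finset.sum_add_distrib (ι := Fin d × Fin d),
    Finset.sum_sub_distrib (ι := Fin d × Fin d), hNp, hNr, hsum, hsum, htrs, htrr] at main
  linarith

open Matrix in
lemma spec_s6 {d : ℕ} {A : Matrix (Fin d) (Fin d) ℂ} (hA : A.IsHermitian) :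
    ∃ U : Matrix (Fin d) (Fin d) ℂ, U * Uᴴ = 1 ∧
      A = U * diagonal (fun i => (hA.eigenvalues i : ℂ)) * Uᴴ := by
  refine ⟨hA.eigenvectorUnitary, ?_, ?_⟩
  · exact Unitary.coe_mul_star_self hA.eigenvectorUnitary
  · have h := hA.spectral_theorem
    rw [Unitary.conjStarAlgAut_apply] at h
    exact h

open Matrix in
/-- **The Holevo bound.** For any input distribution `P`, ensemble of density
matrices `ξ`, and POVM `M` with a finite outcome set `B`, the mutual information
between the input `a ~ P` and the measurement outcome is at most the Holevo
quantity `χ(P, ξ) = H(Σ_a P(a) ξ(a)) − Σ_a P(a) H(ξ(a))`. -/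
theorem holevo_bound
    {A : Type*} [Fintype A] {d : ℕ}
    (P : A → ℝ) (hP : IsProbDist P)
    (ξ : A → Matrix (Fin d) (Fin d) ℂ) (hξ : ∀ a, IsDensity (ξ a))
    {B : Type*} [Fintype B]
    (M : B → Matrix (Fin d) (Fin d) ℂ) (hM : IsPOVM M) :
    measMI P ξ M ≤ holevo P ξ := by
  classical
  obtain ⟨hP0, hP1⟩ := hP
  obtain ⟨hM0, hM1⟩ := hM
  set ρ := ∑ a, (P a : ℂ) • ξ a with hρdef
  have hPξ : ∀ a, ((P a : ℂ) • ξ a).PosSemidef := fun a =>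
    (hξ a).1.smul (by exact_mod_cast hP0 a)
  have hρp : ρ.PosSemidef := Matrix.posSemidef_sum Finset.univ fun a _ => hPξ a
  obtain ⟨V, hV, hρ⟩ := spec_s6 hρp.1
  set r := hρp.1.eigenvalues with hr
  have hV' : Vᴴ * V = 1 := mul_eq_one_comm.1 hV
  have hlog2 : 0 < Real.log 2 := Real.log_pos (by norm_num)
  have hlin : ∀ b, (M b * ρ).trace.re = ∑ a, P a * measProb M (ξ a) b := by
    intro b
    simp [hρdef, Finset.mul_sum, Matrix.trace_sum, measProb]
  have hsum1 : ∀ a, ∑ b, measProb M (ξ a) b = 1 := by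
    intro a
    simp only [measProb]
    rw [← Complex.re_sum, ← Matrix.trace_sum, ← Finset.sum_mul, hM1, Matrix.one_mul, (hξ a).2]
    simp
  have hrr : ∀ j, r j = ∑ a, P a * ((Vᴴ * ξ a * V) j j).re := by
    intro j
    have h2 : Vᴴ * ρ * V = diagonal (fun i => (r i : ℂ)) := by
      rw [hρ]
      calc _ = (Vᴴ * V) * diagonal (fun i => (r i : ℂ)) * (Vᴴ * V) := by
            simp only [Matrix.mul_assoc]
        _ = _ := by rw [hV']; simp
    have h3 : ((Vᴴ * ρ * V) j j).re = r j := by rw [h2]; simp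
    rw [← h3, hρdef]
    simp [Finset.mul_sum, Finset.sum_mul, Matrix.sum_apply]
  -- pointwise data processing inequality
  have hpt : ∀ a, P a * ∑ b, (measProb M (ξ a) b * Real.log (measProb M (ξ a) b) -
      measProb M (ξ a) b * Real.log (M b * ρ).trace.re) ≤
      P a * (∑ i, (hξ a).1.1.eigenvalues i * Real.log ((hξ a).1.1.eigenvalues i) -
        ∑ j, Real.log (r j) * ((Vᴴ * ξ a * V) j j).re) := by
    intro a
    rcases (hP0 a).eq_or_lt with h0 | h0
    · rw [← h0]; simp
    apply mul_le_mul_of_nonneg_left _ h0.le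
    obtain ⟨U, hU, hσ⟩ := spec_s6 (hξ a).1.1
    refine meas_rel M hM0 hM1 U V hU hV _ r (fun i => (hξ a).1.eigenvalues_nonneg i)
      (fun i => hρp.eigenvalues_nonneg i) (ξ a) ρ (hξ a).1 hρp hσ hρ (P a) h0 ?_
    have : ρ - (P a : ℂ) • ξ a = ∑ a' ∈ Finset.univ.erase a, (P a' : ℂ) • ξ a' := by
      rw [hρdef, ← Finset.add_sum_erase _ _ (Finset.mem_univ a), add_sub_cancel_left]
    rw [this]
    exact Matrix.posSemidef_sum _ fun a _ => hPξ a
  have htot := Finset.sum_le_sum fun a (_ : a ∈ (Finset.univ : Finset A)) => hpt a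
  have hR : ∑ a, P a * (∑ i, (hξ a).1.1.eigenvalues i * Real.log ((hξ a).1.1.eigenvalues i) -
        ∑ j, Real.log (r j) * ((Vᴴ * ξ a * V) j j).re) = Real.log 2 * holevo P ξ := by
    have e1 : Real.log 2 * vnEntropy ρ = ∑ j, Real.negMulLog (r j) := by
      rw [vnEntropy, dif_pos hρp.1]
      field_simp
      rfl
    have e2 : ∀ a, Real.log 2 * vnEntropy (ξ a) =
        ∑ i, Real.negMulLog ((hξ a).1.1.eigenvalues i) := by
      intro a
      rw [vnEntropy, dif_pos (hξ a).1.1]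
      field_simp
    have e3 : ∑ a, P a * ∑ j, Real.log (r j) * ((Vᴴ * ξ a * V) j j).re =
        ∑ j, r j * Real.log (r j) := by
      simp only [Finset.mul_sum]
      rw [Finset.sum_comm]
      refine Finset.sum_congr rfl fun j _ => ?_
      conv_rhs => rw [hrr j, Finset.sum_mul]
      rw [← hrr j]
      exact Finset.sum_congr rfl fun a _ => by ring
    rw [holevo, mul_sub, ← hρdef, e1, Finset.mul_sum]
    simp only [mul_sub, Finset.sum_sub_distrib]
    rw [e3]
    have e4 : ∀ a, Real.log 2 * (P a * vnEntropy (ξ a)) =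
        - (P a * ∑ i, (hξ a).1.1.eigenvalues i * Real.log ((hξ a).1.1.eigenvalues i)) := by
      intro a
      rw [mul_left_comm, e2 a]
      simp [Real.negMulLog]
    rw [Finset.sum_congr rfl fun a _ => e4 a]
    simp only [Real.negMulLog, neg_mul, Finset.sum_neg_distrib]
    ring
  have hL : ∑ a, P a * ∑ b, (measProb M (ξ a) b * Real.log (measProb M (ξ a) b) -
      measProb M (ξ a) b * Real.log (M b * ρ).trace.re) = Real.log 2 * measMI P ξ M := by
    have e0 : Real.log 2 * measMI P ξ M =
        ∑ a, Real.negMulLog (∑ b, P a * measProb M (ξ a) b) +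
        ∑ b, Real.negMulLog (∑ a, P a * measProb M (ξ a) b) -
        ∑ k : A × B, Real.negMulLog (P k.1 * measProb M (ξ k.1) k.2) := by
      simp only [measMI, miJoint, entropy]
      field_simp
    rw [e0, Fintype.sum_prod_type]
    simp only [Real.negMulLog_mul, Finset.sum_add_distrib, ← Finset.mul_sum, ← Finset.sum_mul,
      hsum1, mul_one, one_mul]
    have e5 : ∑ b, Real.negMulLog (∑ a, P a * measProb M (ξ a) b) =
        - ∑ a, P a * ∑ b, measProb M (ξ a) b * Real.log (M b * ρ).trace.re := by
      simp only [Finset.mul_sum]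
      rw [Finset.sum_comm, ← Finset.sum_neg_distrib]
      refine Finset.sum_congr rfl fun b _ => ?_
      rw [← hlin b, Real.negMulLog, neg_mul]
      congr 1
      conv_lhs => rw [hlin b, Finset.sum_mul]
      rw [← hlin b]
      exact Finset.sum_congr rfl fun a _ => by ring
    rw [e5]
    simp only [Real.negMulLog, neg_mul, Finset.sum_neg_distrib, Finset.sum_sub_distrib, mul_sub,
      mul_neg]
    ring
  rw [hL, hR] at htot
  exact le_of_mul_le_mul_left htot hlog2

end QKD
end
end
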